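/- arXiv:2111.09447 — 10 statements merged into one kernel-verified Lean document; each statement's English description precedes it below -/
import Mathlib

section
/- Let U, V, W be independent random vectors in R^n, each square-integrable, with E[V] = E[W] and with U and V identically distributed, and let g : R^n -> R^n be a measurable function with E||g(U)||_2^2 < infinity. Then E||V - g(U)||_2^2 = E||W - g(U)||_2^2 + E||U||_2^2 - E||W||_2^2. -/
open MeasureTheory ProbabilityTheory

lemma aux_sq {Ω : Type*} [MeasurableSpace Ω] {μ : Measure Ω} [IsProbabilityMeasure μ]
    (X Y : Ω → ℝ) (hX : MemLp X 2 μ) (hY : MemLp Y 2 μ) (h : IndepFun X Y μ) :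
    (∫ ω, (X ω - Y ω) ^ 2 ∂μ)
      = (∫ ω, X ω ^ 2 ∂μ) - 2 * ((∫ ω, X ω ∂μ) * ∫ ω, Y ω ∂μ) + ∫ ω, Y ω ^ 2 ∂μ := by
  have h1 : Integrable (fun ω => X ω * Y ω) μ := hX.integrable_mul hY
  have h2 := h.integral_fun_mul_eq_mul_integral hX.1 hY.1
  have e : ∀ ω, (X ω - Y ω) ^ 2 = X ω ^ 2 - 2 * (X ω * Y ω) + Y ω ^ 2 := fun ω => by ring
  have h3 : Integrable (fun ω => X ω ^ 2 - 2 * (X ω * Y ω)) μ :=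
    hX.integrable_sq.sub (h1.const_mul 2)
  simp_rw [e]
  rw [integral_add h3 hY.integrable_sq,
    integral_sub hX.integrable_sq (h1.const_mul 2), integral_const_mul, h2]

/-- **Three-point formula, second statement.**
Let `U, V, W` be mutually independent square-integrable random vectors in `ℝⁿ` with
`E[V] = E[W]` and `U, V` identically distributed, and let `g : ℝⁿ → ℝⁿ` be measurable
with `E‖g(U)‖² < ∞`.  Then `E‖V - g(U)‖² = E‖W - g(U)‖² + E‖U‖² - E‖W‖²`. -/
theorem three_point_formula_same_mean
    {Ω : Type*} [MeasurableSpace Ω] {μ : Measure Ω} [IsProbabilityMeasure μ]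
    {n : ℕ} (U V W : Ω → (Fin n → ℝ))
    (hUm : Measurable U) (hVm : Measurable V) (hWm : Measurable W)
    (hIndep : iIndepFun ![U, V, W] μ)
    (hU2 : ∀ i, MemLp (fun ω => U ω i) 2 μ)
    (hV2 : ∀ i, MemLp (fun ω => V ω i) 2 μ)
    (hW2 : ∀ i, MemLp (fun ω => W ω i) 2 μ)
    (hmean : ∀ i, (∫ ω, V ω i ∂μ) = ∫ ω, W ω i ∂μ)
    (hUV : Measure.map U μ = Measure.map V μ)
    (g : (Fin n → ℝ) → (Fin n → ℝ)) (hg : Measurable g)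
    (hgU : Integrable (fun ω => ∑ i, (g (U ω) i) ^ 2) μ) :
    (∫ ω, ∑ i, (V ω i - g (U ω) i) ^ 2 ∂μ)
      = (∫ ω, ∑ i, (W ω i - g (U ω) i) ^ 2 ∂μ)
        + (∫ ω, ∑ i, (U ω i) ^ 2 ∂μ) - (∫ ω, ∑ i, (W ω i) ^ 2 ∂μ) := by
  have hGm : ∀ i, Measurable (fun ω => g (U ω) i) := fun i =>
    (measurable_pi_apply i).comp (hg.comp hUm)
  have hG2 : ∀ i, MemLp (fun ω => g (U ω) i) 2 μ := by
    intro i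
    rw [memLp_two_iff_integrable_sq (hGm i).aestronglyMeasurable]
    refine hgU.mono' ((hGm i).pow_const 2).aestronglyMeasurable (ae_of_all _ fun ω => ?_)
    rw [Real.norm_of_nonneg (sq_nonneg _)]
    exact Finset.single_le_sum (f := fun i => (g (U ω) i) ^ 2)
      (fun j _ => sq_nonneg _) (Finset.mem_univ i)
  have hVU : IndepFun V U μ := hIndep.indepFun (i := 1) (j := 0) (by decide)
  have hWU : IndepFun W U μ := hIndep.indepFun (i := 2) (j := 0) (by decide)
  have hgi : ∀ i, Measurable (fun x => g x i) := fun i => (measurable_pi_apply i).comp hg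
  have hUsq : ∀ i, (∫ ω, (U ω i) ^ 2 ∂μ) = ∫ ω, (V ω i) ^ 2 ∂μ := by
    intro i
    have hm : Measurable (fun x : Fin n → ℝ => (x i) ^ 2) := (measurable_pi_apply i).pow_const 2
    have a := integral_map (μ := μ) hUm.aemeasurable hm.aestronglyMeasurable
    have b := integral_map (μ := μ) hVm.aemeasurable hm.aestronglyMeasurable
    rw [← a, ← b, hUV]
  have hVG : ∀ i, Integrable (fun ω => (V ω i - g (U ω) i) ^ 2) μ := fun i =>
    ((hV2 i).sub (hG2 i)).integrable_sq
  have hWG : ∀ i, Integrable (fun ω => (W ω i - g (U ω) i) ^ 2) μ := fun i =>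
    ((hW2 i).sub (hG2 i)).integrable_sq
  rw [integral_finsetSum _ fun i _ => hVG i,
    integral_finsetSum _ fun i _ => hWG i,
    integral_finsetSum _ fun i _ => (hU2 i).integrable_sq,
    integral_finsetSum _ fun i _ => (hW2 i).integrable_sq,
    ← Finset.sum_add_distrib, ← Finset.sum_sub_distrib]
  refine Finset.sum_congr rfl fun i _ => ?_
  have a : (∫ ω, (V ω i - g (U ω) i) ^ 2 ∂μ) = _ := aux_sq _ _ (hV2 i) (hG2 i) (hVU.comp (measurable_pi_apply i) (hgi i))
  have b : (∫ ω, (W ω i - g (U ω) i) ^ 2 ∂μ) = _ := aux_sq _ _ (hW2 i) (hG2 i) (hWU.comp (measurable_pi_apply i) (hgi i))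
  rw [a, b, hmean i, hUsq i]
  ring
end

section
/- Let Y ~ N(theta, sigma^2 I_n) with theta in R^n and sigma^2 > 0. Fix alpha > 0 and an integer B >= 1, let omega^1, ..., omega^B be i.i.d. N(0, sigma^2 I_n) random vectors independent of Y, and set Y^{*b} = Y + sqrt(alpha) * omega^b and Y^{dagger b} = Y - omega^b / sqrt(alpha) for each b. Let g : R^n -> R^n be measurable with E||g(Y_alpha)||_2^2 < infinity, where Y_alpha ~ N(theta, (1+alpha) sigma^2 I_n). Define the coupled bootstrap estimator CB_alpha(g) = (1/B) * sum_{b=1}^B ( ||Y^{dagger b} - g(Y^{*b})||_2^2 - ||omega^b||_2^2 / alpha ) - n sigma^2. Then E[CB_alpha(g)] = Risk_alpha(g), where Risk_alpha(g) = E||theta - g(Y_alpha)||_2^2 is the risk of g at the elevated noise level (1+alpha) sigma^2. -/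
open MeasureTheory ProbabilityTheory

/-- The distribution `N(m, v I_n)` on `ℝⁿ`, i.e. the product of one-dimensional Gaussians
with means `m i` and common variance `v`. -/
noncomputable def gaussianPi (n : ℕ) (m : Fin n → ℝ) (v : ℝ) : Measure (Fin n → ℝ) :=
  Measure.pi fun i => gaussianReal (m i) v.toNNReal

lemma gp_eval {Ω : Type*} [MeasurableSpace Ω] {μ : Measure Ω}
    {n : ℕ} {m : Fin n → ℝ} {v : ℝ} {X : Ω → Fin n → ℝ}
    (hX : Measurable X) (h : Measure.map X μ = gaussianPi n m v) (i : Fin n) :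
    Measure.map (fun ω => X ω i) μ = gaussianReal (m i) v.toNNReal := by
  have : Measure.map (fun ω => X ω i) μ = Measure.map (fun x => x i) (Measure.map X μ) := by
    rw [Measure.map_map (by fun_prop) hX]; rfl
  rw [this, h, gaussianPi]
  exact (measurePreserving_eval _ i).map_eq

lemma gp_indep {Ω : Type*} [MeasurableSpace Ω] {μ : Measure Ω} [IsProbabilityMeasure μ]
    {n : ℕ} {m : Fin n → ℝ} {v : ℝ} {X : Ω → Fin n → ℝ}
    (hX : Measurable X) (h : Measure.map X μ = gaussianPi n m v) :
    iIndepFun (fun i ω => X ω i) μ := by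
  rw [iIndepFun_iff_map_fun_eq_pi_map (fun i => by fun_prop)]
  simp_rw [gp_eval hX h]
  exact h

lemma gp_gauss {Ω : Type*} [MeasurableSpace Ω] {μ : Measure Ω} [IsProbabilityMeasure μ]
    {n : ℕ} {m : Fin n → ℝ} {v : ℝ} {X : Ω → Fin n → ℝ}
    (hX : Measurable X) (h : Measure.map X μ = gaussianPi n m v) :
    HasGaussianLaw X μ :=
  (gp_indep hX h).hasGaussianLaw (fun i => ⟨by rw [gp_eval hX h]; infer_instance⟩)

lemma gp_memLp {Ω : Type*} [MeasurableSpace Ω] {μ : Measure Ω} [IsProbabilityMeasure μ]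
    {n : ℕ} {m : Fin n → ℝ} {v : ℝ} {X : Ω → Fin n → ℝ}
    (hX : Measurable X) (h : Measure.map X μ = gaussianPi n m v) (i : Fin n) :
    MemLp (fun ω => X ω i) 2 μ := ((gp_gauss hX h).eval i).memLp_two

lemma gp_mean {Ω : Type*} [MeasurableSpace Ω] {μ : Measure Ω} [IsProbabilityMeasure μ]
    {n : ℕ} {m : Fin n → ℝ} {v : ℝ} {X : Ω → Fin n → ℝ}
    (hX : Measurable X) (h : Measure.map X μ = gaussianPi n m v) (i : Fin n) :
    ∫ ω, X ω i ∂μ = m i := by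
  have := integral_map (μ := μ) (φ := fun ω => X ω i) (by fun_prop)
    (f := fun x : ℝ => x) (by fun_prop)
  rw [← this, gp_eval hX h]; simp

lemma gp_cov {Ω : Type*} [MeasurableSpace Ω] {μ : Measure Ω} [IsProbabilityMeasure μ]
    {n : ℕ} {m : Fin n → ℝ} {v : ℝ} (hv : 0 ≤ v) {X : Ω → Fin n → ℝ}
    (hX : Measurable X) (h : Measure.map X μ = gaussianPi n m v) (i j : Fin n) :
    cov[fun ω => X ω i, fun ω => X ω j; μ] = if i = j then v else 0 := by
  split_ifs with hij
  · subst hij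
    rw [covariance_self (by fun_prop), ← variance_id_map (by fun_prop), gp_eval hX h]
    simp [hv]
  · exact ((gp_indep hX h).indepFun hij).covariance_eq_zero (gp_memLp hX h i) (gp_memLp hX h j)

lemma gp_of {Ω : Type*} [MeasurableSpace Ω] {μ : Measure Ω} [IsProbabilityMeasure μ]
    {n : ℕ} {m : Fin n → ℝ} {v : ℝ} {X : Ω → Fin n → ℝ} (hX : Measurable X)
    (hG : HasGaussianLaw X μ) (hm : ∀ i, ∫ ω, X ω i ∂μ = m i)
    (hc : ∀ i j, cov[fun ω => X ω i, fun ω => X ω j; μ] = if i = j then v else 0) :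
    Measure.map X μ = gaussianPi n m v := by
  have hI : iIndepFun (fun i ω => X ω i) μ :=
    HasGaussianLaw.iIndepFun_of_covariance_eq_zero hG (fun i j hij => by rw [hc, if_neg hij])
  rw [iIndepFun_iff_map_fun_eq_pi_map (fun i => by fun_prop)] at hI
  have he : ∀ i, Measure.map (fun ω => X ω i) μ = gaussianReal (m i) v.toNNReal := by
    intro i
    rw [(hG.eval i).map_eq_gaussianReal, hm, ← covariance_self (by fun_prop), hc, if_pos rfl]
  simp_rw [he] at hI
  exact hI

lemma cb_one {Ω : Type*} [MeasurableSpace Ω] {μ : Measure Ω} [IsProbabilityMeasure μ]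
    {n : ℕ} (θ : Fin n → ℝ) (σ2 : ℝ) (hσ2 : 0 < σ2) (α : ℝ) (hα : 0 < α)
    (Y W : Ω → (Fin n → ℝ)) (hY : Measurable Y) (hW : Measurable W)
    (hI : IndepFun Y W μ)
    (hYlaw : Measure.map Y μ = gaussianPi n θ σ2)
    (hWlaw : Measure.map W μ = gaussianPi n 0 σ2)
    (g : (Fin n → ℝ) → (Fin n → ℝ)) (hg : Measurable g)
    (hgint : Integrable (fun y => ∑ i, (g y i) ^ 2) (gaussianPi n θ ((1 + α) * σ2))) :
    Integrable (fun ω' => (∑ i, (Y ω' i - W ω' i / Real.sqrt α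
            - g (fun j => Y ω' j + Real.sqrt α * W ω' j) i) ^ 2)
          - (∑ i, (W ω' i) ^ 2) / α) μ ∧
    ∫ ω', ((∑ i, (Y ω' i - W ω' i / Real.sqrt α
            - g (fun j => Y ω' j + Real.sqrt α * W ω' j) i) ^ 2)
          - (∑ i, (W ω' i) ^ 2) / α) ∂μ
      = n * σ2 + ∫ y, ∑ i, (θ i - g y i) ^ 2 ∂(gaussianPi n θ ((1 + α) * σ2)) := by
  set s := Real.sqrt α with hs
  have hs0 : 0 < s := Real.sqrt_pos.2 hα
  have hss : s * s = α := Real.mul_self_sqrt hα.le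
  have hGYW := hI.hasGaussianLaw (gp_gauss hY hYlaw) (gp_gauss hW hWlaw)
  let U : Ω → Fin n → ℝ := fun ω j => Y ω j + s * W ω j
  let V : Ω → Fin n → ℝ := fun ω j => Y ω j - W ω j / s
  have hU : Measurable U := by fun_prop
  have hV : Measurable V := by fun_prop
  let L : ((Fin n → ℝ) × (Fin n → ℝ)) →L[ℝ] ((Fin n → ℝ) × (Fin n → ℝ)) :=
    ContinuousLinearMap.prod
      (ContinuousLinearMap.fst ℝ (Fin n → ℝ) (Fin n → ℝ)
        + s • ContinuousLinearMap.snd ℝ (Fin n → ℝ) (Fin n → ℝ))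
      (ContinuousLinearMap.fst ℝ (Fin n → ℝ) (Fin n → ℝ)
        - s⁻¹ • ContinuousLinearMap.snd ℝ (Fin n → ℝ) (Fin n → ℝ))
  have hGUV : HasGaussianLaw (fun ω => (fun i => U ω i, fun i => V ω i)) μ := by
    refine (hGYW.map_fun L).congr (Filter.Eventually.of_forall fun ω => ?_)
    ext i
    · simp [L, U]
    · simp [L, V]; ring
  have hYm := gp_memLp hY hYlaw
  have hWm := gp_memLp hW hWlaw
  have hcYW : ∀ i j, cov[fun ω => Y ω i, fun ω => W ω j; μ] = 0 := fun i j =>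
    (hI.comp (measurable_pi_apply i) (measurable_pi_apply j)).covariance_eq_zero (hYm i) (hWm j)
  have hcWY : ∀ i j, cov[fun ω => W ω i, fun ω => Y ω j; μ] = 0 := fun i j => by
    rw [covariance_comm, hcYW]
  have hcY := gp_cov hσ2.le hY hYlaw
  have hcW := gp_cov hσ2.le hW hWlaw
  have key : ∀ (a b : ℝ) (i j : Fin n),
      cov[fun ω => Y ω i + a * W ω i, fun ω => Y ω j + b * W ω j; μ]
        = if i = j then (1 + a * b) * σ2 else 0 := by
    intro a b i j
    have e1 : (fun ω => Y ω i + a * W ω i) = (fun ω => Y ω i) + (fun ω => a * W ω i) := rfl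
    have e2 : (fun ω => Y ω j + b * W ω j) = (fun ω => Y ω j) + (fun ω => b * W ω j) := rfl
    rw [e1, e2, covariance_add_left (hYm i) ((hWm i).const_mul a)
        ((hYm j).add ((hWm j).const_mul b)),
      covariance_add_right (hYm i) (hYm j) ((hWm j).const_mul b),
      covariance_add_right ((hWm i).const_mul a) (hYm j) ((hWm j).const_mul b),
      covariance_const_mul_left, covariance_const_mul_right, covariance_const_mul_left,
      covariance_const_mul_right, hcYW, hcWY, hcY, hcW]
    split_ifs <;> ring
  have hVeq : ∀ i, (fun ω => V ω i) = fun ω => Y ω i + (-s⁻¹) * W ω i := by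
    intro i; ext ω; simp only [V]; ring
  have hUV : IndepFun U V μ := by
    refine HasGaussianLaw.indepFun_of_covariance_eval (X := fun i ω => U ω i)
      (Y := fun i ω => V ω i) hGUV (fun i j => ?_)
    rw [hVeq]
    refine (key s (-s⁻¹) i j).trans ?_
    have : 1 + s * -s⁻¹ = 0 := by field_simp; ring
    rw [this, zero_mul, ite_self]
  have hYi := fun i => (hYm i).integrable (by norm_num)
  have hWi := fun i => (hWm i).integrable (by norm_num)
  have hUlaw : Measure.map U μ = gaussianPi n θ ((1 + α) * σ2) := by
    refine gp_of hU hGUV.fst (fun i => ?_) (fun i j => ?_)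
    · simp only [U]
      rw [integral_add (hYi i) ((hWi i).const_mul s), integral_const_mul, gp_mean hY hYlaw,
        gp_mean hW hWlaw]
      simp
    · rw [← hss]; exact key s s i j
  have hVlaw : Measure.map V μ = gaussianPi n θ ((1 + α⁻¹) * σ2) := by
    refine gp_of hV hGUV.snd (fun i => ?_) (fun i j => ?_)
    · simp only [V]
      rw [integral_sub (hYi i) ((hWi i).div_const s), integral_div, gp_mean hY hYlaw,
        gp_mean hW hWlaw]
      simp
    · rw [hVeq, hVeq, key, ← hss]
      congr 2
      field_simp
  have hαi : 0 ≤ (1 + α⁻¹) * σ2 := by positivity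
  -- square integrability of g
  have hprob : IsProbabilityMeasure (gaussianPi n θ ((1 + α) * σ2)) := by
    unfold gaussianPi; infer_instance
  have hgm : ∀ i, MemLp (fun y => θ i - g y i) 2 (gaussianPi n θ ((1 + α) * σ2)) := by
    intro i
    refine (memLp_const _).sub ((memLp_two_iff_integrable_sq (by fun_prop)).2 ?_)
    refine hgint.mono' (by fun_prop) (Filter.Eventually.of_forall fun y => ?_)
    rw [Real.norm_of_nonneg (sq_nonneg _)]
    exact Finset.single_le_sum (f := fun i => g y i ^ 2) (fun i _ => sq_nonneg _)
      (Finset.mem_univ i)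
  have hGm : ∀ i, MemLp (fun ω => θ i - g (U ω) i) 2 μ := by
    intro i
    have := hgm i
    rw [← hUlaw] at this
    exact this.comp_of_map (by fun_prop)
  have hVm : ∀ i, MemLp (fun ω => V ω i - θ i) 2 μ := fun i =>
    (gp_memLp hV hVlaw i).sub (memLp_const _)
  have hV0 : ∀ i, ∫ ω, (V ω i - θ i) ∂μ = 0 := by
    intro i
    rw [integral_sub ((gp_memLp hV hVlaw i).integrable (by norm_num)) (integrable_const _),
      gp_mean hV hVlaw]
    simp
  have hV2 : ∀ i, ∫ ω, (V ω i - θ i) ^ 2 ∂μ = (1 + α⁻¹) * σ2 := by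
    intro i
    have := gp_cov hαi hV hVlaw i i
    rw [covariance_self (by fun_prop), variance_eq_integral (by fun_prop),
      gp_mean hV hVlaw] at this
    simpa using this
  have hW2 : ∀ i, ∫ ω, (W ω i) ^ 2 ∂μ = σ2 := by
    intro i
    have := gp_cov hσ2.le hW hWlaw i i
    rw [covariance_self (by fun_prop), variance_eq_integral (by fun_prop),
      gp_mean hW hWlaw] at this
    simpa using this
  have hcross : ∀ i, ∫ ω, (V ω i - θ i) * (θ i - g (U ω) i) ∂μ = 0 := by
    intro i
    have hi : IndepFun (fun ω => V ω i - θ i) (fun ω => θ i - g (U ω) i) μ :=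
      hUV.symm.comp (φ := fun v : Fin n → ℝ => v i - θ i) (ψ := fun u => θ i - g u i)
        (by fun_prop) (by fun_prop)
    rw [hi.integral_fun_mul_eq_mul_integral (hVm i).1 (hGm i).1, hV0, zero_mul]
  have hci : ∀ i, Integrable (fun ω => (V ω i - θ i) * (θ i - g (U ω) i)) μ := fun i =>
    (hVm i).integrable_mul (hGm i)
  have hexp : ∀ i, (fun ω => (V ω i - g (U ω) i) ^ 2) = fun ω =>
      ((V ω i - θ i) ^ 2 + (θ i - g (U ω) i) ^ 2)
        + 2 * ((V ω i - θ i) * (θ i - g (U ω) i)) := by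
    intro i; ext ω; ring
  have hint1 : ∀ i, Integrable (fun ω => (V ω i - g (U ω) i) ^ 2) μ := by
    intro i
    rw [hexp]
    exact ((hVm i).integrable_sq.add (hGm i).integrable_sq).add ((hci i).const_mul 2)
  have hval : ∀ i, ∫ ω, (V ω i - g (U ω) i) ^ 2 ∂μ
      = (1 + α⁻¹) * σ2 + ∫ ω, (θ i - g (U ω) i) ^ 2 ∂μ := by
    intro i
    have hs2 : Integrable (fun ω => (V ω i - θ i) ^ 2 + (θ i - g (U ω) i) ^ 2) μ :=
      (hVm i).integrable_sq.add (hGm i).integrable_sq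
    rw [hexp, integral_add hs2 ((hci i).const_mul 2), integral_add (hVm i).integrable_sq (hGm i).integrable_sq,
      integral_const_mul, hcross, hV2]
    ring
  have I1 : Integrable (fun ω => ∑ i, (V ω i - g (U ω) i) ^ 2) μ :=
    integrable_finsetSum _ fun i _ => hint1 i
  have I2 : Integrable (fun ω => (∑ i, (W ω i) ^ 2) / α) μ :=
    (integrable_finsetSum _ fun i _ => (hWm i).integrable_sq).div_const α
  refine ⟨I1.sub I2, ?_⟩
  have hR : ∫ y, ∑ i, (θ i - g y i) ^ 2 ∂(gaussianPi n θ ((1 + α) * σ2))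
      = ∑ i, ∫ ω, (θ i - g (U ω) i) ^ 2 ∂μ := by
    rw [← hUlaw, integral_map hU.aemeasurable
        (Measurable.aestronglyMeasurable (by fun_prop)),
      integral_finsetSum _ fun i _ => (hGm i).integrable_sq]
  refine (integral_sub I1 I2).trans ?_
  rw [hR, integral_finsetSum _ fun i _ => hint1 i, integral_div,
    integral_finsetSum _ fun i _ => (hWm i).integrable_sq]
  simp_rw [hval, hW2]
  rw [Finset.sum_add_distrib]
  simp only [Finset.sum_const, Finset.card_univ, Fintype.card_fin, nsmul_eq_mul]
  field_simp
  ring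

/-- **Unbiasedness of the coupled bootstrap estimator (Corollary 1).**
Let `Y ~ N(θ, σ² Iₙ)`, let `ω¹, …, ω^B` be i.i.d. `N(0, σ² Iₙ)` independent of `Y`, and set
`Y^{*b} = Y + √α ωᵇ`, `Y^{†b} = Y - ωᵇ/√α`.  For any measurable `g` with
`E‖g(Y_α)‖² < ∞` (where `Y_α ~ N(θ, (1+α) σ² Iₙ)`), the coupled bootstrap estimator
`CB_α(g) = B⁻¹ ∑_b (‖Y^{†b} - g(Y^{*b})‖² - ‖ωᵇ‖²/α) - n σ²` satisfies
`E[CB_α(g)] = Risk_α(g) = E‖θ - g(Y_α)‖²`. -/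
theorem coupled_bootstrap_unbiased
    {Ω : Type*} [MeasurableSpace Ω] {μ : Measure Ω} [IsProbabilityMeasure μ]
    {n : ℕ} (θ : Fin n → ℝ) (σ2 : ℝ) (hσ2 : 0 < σ2) (α : ℝ) (hα : 0 < α)
    (B : ℕ) (hB : 1 ≤ B)
    (Y : Ω → (Fin n → ℝ)) (w : Fin B → Ω → (Fin n → ℝ))
    (hY : Measurable Y) (hw : ∀ b, Measurable (w b))
    (hIndep : iIndepFun
      (fun o : Option (Fin B) => Option.elim o Y w) μ)
    (hYlaw : Measure.map Y μ = gaussianPi n θ σ2)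
    (hwlaw : ∀ b, Measure.map (w b) μ = gaussianPi n 0 σ2)
    (g : (Fin n → ℝ) → (Fin n → ℝ)) (hg : Measurable g)
    (hgint : Integrable (fun y => ∑ i, (g y i) ^ 2) (gaussianPi n θ ((1 + α) * σ2))) :
    (∫ ω', ((B : ℝ)⁻¹ * (∑ b,
        ((∑ i, (Y ω' i - w b ω' i / Real.sqrt α
            - g (fun j => Y ω' j + Real.sqrt α * w b ω' j) i) ^ 2)
          - (∑ i, (w b ω' i) ^ 2) / α))
        - n * σ2) ∂μ)
      = ∫ y, ∑ i, (θ i - g y i) ^ 2 ∂(gaussianPi n θ ((1 + α) * σ2)) := by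
  have hone := fun b => cb_one (μ := μ) θ σ2 hσ2 α hα Y (w b) hY (hw b)
    (hIndep.indepFun (i := none) (j := some b) (by simp)) hYlaw (hwlaw b) g hg hgint
  have hB0 : (B : ℝ) ≠ 0 := by positivity
  rw [integral_sub ((integrable_finsetSum _ fun b _ => (hone b).1).const_mul _)
    (integrable_const _), integral_const_mul, integral_finsetSum _ fun b _ => (hone b).1]
  simp_rw [fun b => (hone b).2]
  simp only [Finset.sum_const, Finset.card_univ, Fintype.card_fin, nsmul_eq_mul,
    integral_const, probReal_univ, one_smul]
  field_simp
  ring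
end

section
/- For alpha >= 0 let Y_alpha ~ N(theta, (1+alpha) sigma^2 I_n), where theta is in R^n and sigma^2 > 0. Let f : R^n -> R be a measurable function such that, for some beta > 0 and integer k >= 0, E[ |f(Y_beta)| * ||Y_beta - theta||_2^{2m} ] < infinity for each m = 0, 1, ..., k. Then the map alpha |-> E[f(Y_alpha)] is k times continuously differentiable on the interval [0, beta). -/
open MeasureTheory ProbabilityTheory

lemma gpi_density {n : ℕ} (θ : Fin n → ℝ) (v : ℝ) (hv : 0 < v) :
    gaussianPi n θ v = (volume : Measure (Fin n → ℝ)).withDensity (fun y => ENNReal.ofReal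
      (∏ i, gaussianPDFReal (θ i) v.toNNReal (y i))) := by
  have hv' : v.toNNReal ≠ 0 := by simpa using hv
  unfold gaussianPi
  refine Measure.pi_eq fun s hs => ?_
  rw [withDensity_apply _ (MeasurableSet.univ_pi hs), volume_pi, Measure.restrict_pi_pi,
    ← ofReal_integral_eq_lintegral_ofReal]
  · rw [integral_fintype_prod_eq_prod
      (f := fun i x => gaussianPDFReal (θ i) v.toNNReal x),
      ENNReal.ofReal_prod_of_nonneg]
    · exact Finset.prod_congr rfl fun i _ =>
        (gaussianReal_apply_eq_integral (θ i) hv' (s i)).symm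
    · intro i _
      exact integral_nonneg fun x => gaussianPDFReal_nonneg _ _ _
  · exact Integrable.fintype_prod (f := fun i x => gaussianPDFReal (θ i) v.toNNReal x)
      fun i => (integrable_gaussianPDFReal _ _).restrict
  · exact ae_of_all _ fun y => Finset.prod_nonneg fun i _ => gaussianPDFReal_nonneg _ _ _

lemma gpi_prod {n : ℕ} (θ : Fin n → ℝ) (v : ℝ) (hv : 0 < v) (y : Fin n → ℝ) :
    ∏ i, gaussianPDFReal (θ i) v.toNNReal (y i)
      = ((√(2 * Real.pi * v))⁻¹) ^ n * Real.exp (-(1 / (2 * v)) * ∑ i, (y i - θ i) ^ 2) := by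
  simp only [gaussianPDFReal, Real.coe_toNNReal v hv.le, Finset.prod_mul_distrib,
    Finset.prod_const, Finset.card_univ, Fintype.card_fin, ← Real.exp_sum, Finset.mul_sum]
  congr 2
  refine Finset.sum_congr rfl fun i _ => ?_
  ring

lemma gpi_integral {n : ℕ} (θ : Fin n → ℝ) (v : ℝ) (hv : 0 < v) (f : (Fin n → ℝ) → ℝ) :
    ∫ y, f y ∂(gaussianPi n θ v) = ((√(2 * Real.pi * v))⁻¹) ^ n *
      ∫ y, Real.exp (-(1 / (2 * v)) * ∑ i, (y i - θ i) ^ 2) * f y := by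
  have h0 : ∀ y : Fin n → ℝ, 0 ≤ ∏ i, gaussianPDFReal (θ i) v.toNNReal (y i) := fun y =>
    Finset.prod_nonneg fun i _ => gaussianPDFReal_nonneg _ _ _
  rw [gpi_density θ v hv, integral_withDensity_eq_integral_toReal_smul]
  · rw [← integral_const_mul]
    refine integral_congr_ae (ae_of_all _ fun y => ?_)
    simp only [ENNReal.toReal_ofReal (h0 y), smul_eq_mul]
    rw [gpi_prod θ v hv, mul_assoc]
  · fun_prop
  · exact ae_of_all _ fun y => ENNReal.ofReal_lt_top

lemma gpi_integrable {n : ℕ} (θ : Fin n → ℝ) (v : ℝ) (hv : 0 < v) (f : (Fin n → ℝ) → ℝ)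
    (h : Integrable f (gaussianPi n θ v)) :
    Integrable (fun y => Real.exp (-(1 / (2 * v)) * ∑ i, (y i - θ i) ^ 2) * f y) := by
  have h0 : ∀ y : Fin n → ℝ, 0 ≤ ∏ i, gaussianPDFReal (θ i) v.toNNReal (y i) := fun y =>
    Finset.prod_nonneg fun i _ => gaussianPDFReal_nonneg _ _ _
  rw [gpi_density θ v hv, integrable_withDensity_iff_integrable_smul'] at h
  · refine (h.const_mul ((((√(2 * Real.pi * v))⁻¹) ^ n)⁻¹)).congr (ae_of_all _ fun y => ?_)
    simp only [ENNReal.toReal_ofReal (h0 y), smul_eq_mul]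
    rw [gpi_prod θ v hv]
    have : ((√(2 * Real.pi * v))⁻¹) ^ n ≠ 0 := by positivity
    field_simp
  · fun_prop
  · exact ae_of_all _ fun y => ENNReal.ofReal_lt_top

lemma laplace_int {n : ℕ} (S g : (Fin n → ℝ) → ℝ) (hS : Measurable S) (hS0 : ∀ y, 0 ≤ S y)
    (hg : Measurable g) (b : ℝ)
    (h : Integrable (fun y => Real.exp (b * S y) * g y)) (t : ℝ) (ht : t ≤ b) :
    Integrable (fun y => Real.exp (t * S y) * g y) := by
  refine h.mono (by fun_prop) (ae_of_all _ fun y => ?_)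
  rw [norm_mul, norm_mul, Real.norm_of_nonneg (Real.exp_nonneg _),
    Real.norm_of_nonneg (Real.exp_nonneg _)]
  have := hS0 y
  gcongr

lemma laplace_analytic {n : ℕ} (S g : (Fin n → ℝ) → ℝ) (hS : Measurable S) (hS0 : ∀ y, 0 ≤ S y)
    (hg : Measurable g) (hg0 : ∀ y, 0 ≤ g y) (b : ℝ)
    (h : Integrable (fun y => Real.exp (b * S y) * g y)) (t : ℝ) (ht : t < b) :
    AnalyticAt ℝ (fun t => ∫ y, Real.exp (t * S y) * g y) t := by
  have hE : (fun t => ∫ y, Real.exp (t * S y) * g y)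
      = mgf S ((volume : Measure (Fin n → ℝ)).withDensity (fun y => ENNReal.ofReal (g y))) := by
    ext t
    rw [mgf, integral_withDensity_eq_integral_toReal_smul (by fun_prop)
      (ae_of_all _ fun y => ENNReal.ofReal_lt_top)]
    refine integral_congr_ae (ae_of_all _ fun y => ?_)
    simp only [ENNReal.toReal_ofReal (hg0 y), smul_eq_mul]
    ring
  rw [hE]
  apply analyticAt_mgf
  refine interior_mono (s := Set.Iio b) ?_ (by simpa using ht)
  intro u hu
  rw [integrableExpSet, Set.mem_ofPred_eq, integrable_withDensity_iff_integrable_smul' (by fun_prop)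
      (ae_of_all _ fun y => ENNReal.ofReal_lt_top)]
  refine (laplace_int S g hS hS0 hg b h u (le_of_lt hu)).congr (ae_of_all _ fun y => ?_)
  simp only [ENNReal.toReal_ofReal (hg0 y), smul_eq_mul]
  ring

lemma laplace_analytic' {n : ℕ} (S f : (Fin n → ℝ) → ℝ) (hS : Measurable S) (hS0 : ∀ y, 0 ≤ S y)
    (hf : Measurable f) (b : ℝ)
    (h : Integrable (fun y => Real.exp (b * S y) * |f y|)) (t : ℝ) (ht : t < b) :
    AnalyticAt ℝ (fun t => ∫ y, Real.exp (t * S y) * f y) t := by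
  have hp : Integrable (fun y => Real.exp (b * S y) * max (f y) 0) := by
    refine h.mono (by fun_prop) (ae_of_all _ fun y => ?_)
    rw [norm_mul, norm_mul, Real.norm_eq_abs (max _ _), Real.norm_eq_abs |f y|, abs_abs]
    refine mul_le_mul_of_nonneg_left ?_ (norm_nonneg _)
    rcases max_cases (f y) 0 with h | h <;> simp [h.1]
  have hm : Integrable (fun y => Real.exp (b * S y) * max (-f y) 0) := by
    refine h.mono (by fun_prop) (ae_of_all _ fun y => ?_)
    rw [norm_mul, norm_mul, Real.norm_eq_abs (max _ _), Real.norm_eq_abs |f y|, abs_abs]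
    refine mul_le_mul_of_nonneg_left ?_ (norm_nonneg _)
    rcases max_cases (-f y) 0 with h | h <;> simp [h.1]
  have h1 := laplace_analytic S (fun y => max (f y) 0) hS hS0 (by fun_prop)
    (fun y => le_max_right _ _) b hp t ht
  have h2 := laplace_analytic S (fun y => max (-f y) 0) hS hS0 (by fun_prop)
    (fun y => le_max_right _ _) b hm t ht
  refine (h1.sub h2).congr ?_
  filter_upwards [Iio_mem_nhds ht] with u hu
  have hu' : u ≤ b := le_of_lt hu
  simp only [Pi.sub_apply]
  rw [← integral_sub (laplace_int S _ hS hS0 (by fun_prop) b hp u hu')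
    (laplace_int S _ hS hS0 (by fun_prop) b hm u hu')]
  refine integral_congr_ae (ae_of_all _ fun y => ?_)
  simp only
  rw [← mul_sub]
  congr 1
  rcases le_total (f y) 0 with h | h
  · rw [max_eq_right h, max_eq_left (by linarith)]; ring
  · rw [max_eq_left h, max_eq_right (by linarith)]; ring

/-- **Smoothness of Gaussian expectations in the noise-inflation parameter (Lemma 1).**
For `α ≥ 0` let `Y_α ~ N(θ, (1+α) σ² Iₙ)`.  If for some `β > 0` and integer `k ≥ 0` one has
`E[|f(Y_β)| ‖Y_β - θ‖^{2m}] < ∞` for each `m = 0, …, k`, then `α ↦ E[f(Y_α)]` is `k` times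
continuously differentiable on `[0, β)`. -/
theorem gaussian_expectation_smooth
    {n : ℕ} (θ : Fin n → ℝ) (σ2 : ℝ) (hσ2 : 0 < σ2)
    (f : (Fin n → ℝ) → ℝ) (hf : Measurable f)
    (β : ℝ) (hβ : 0 < β) (k : ℕ)
    (hmom : ∀ m : ℕ, m ≤ k →
      Integrable (fun y => |f y| * (∑ i, (y i - θ i) ^ 2) ^ m)
        (gaussianPi n θ ((1 + β) * σ2))) :
    ContDiffOn ℝ k (fun α : ℝ => ∫ y, f y ∂(gaussianPi n θ ((1 + α) * σ2)))
      (Set.Ico 0 β) := by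
  have hb : 0 < (1 + β) * σ2 := by positivity
  have h := hmom 0 (Nat.zero_le k)
  simp only [pow_zero, mul_one] at h
  have h' := gpi_integrable θ _ hb _ h
  have key : ∀ α ∈ Set.Ico 0 β, ContDiffAt ℝ k (fun α : ℝ =>
      ((√(2 * Real.pi * ((1 + α) * σ2)))⁻¹) ^ n *
      ∫ y, Real.exp (-(1 / (2 * ((1 + α) * σ2))) * ∑ i, (y i - θ i) ^ 2) * f y) α := by
    intro α hα
    have hα1 : 0 < 1 + α := by linarith [hα.1]
    have hα0 : 0 < (1 + α) * σ2 := by positivity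
    have ht : -(1 / (2 * ((1 + α) * σ2))) < -(1 / (2 * ((1 + β) * σ2))) := by
      have := hα.2
      gcongr
    have hA := (laplace_analytic' (fun y : Fin n → ℝ => ∑ i, (y i - θ i) ^ 2) f (by fun_prop)
      (fun y => Finset.sum_nonneg fun i _ => sq_nonneg _) hf _ h' _ ht).contDiffAt (n := k)
    have hI : ContDiffAt ℝ k (fun α : ℝ => -(1 / (2 * ((1 + α) * σ2)))) α := by
      refine (ContDiffAt.div contDiffAt_const (by fun_prop) ?_).neg
      positivity
    have hc : ContDiffAt ℝ k (fun α : ℝ => ((√(2 * Real.pi * ((1 + α) * σ2)))⁻¹) ^ n) α := by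
      refine ContDiffAt.pow (ContDiffAt.inv (ContDiffAt.sqrt (by fun_prop) ?_) ?_) n
      · positivity
      · positivity
    have hcomp := ContDiffAt.comp (f := fun α : ℝ => -(1 / (2 * ((1 + α) * σ2)))) α hA hI
    exact hc.mul hcomp
  have key2 : ContDiffOn ℝ k (fun α : ℝ =>
      ((√(2 * Real.pi * ((1 + α) * σ2)))⁻¹) ^ n *
      ∫ y, Real.exp (-(1 / (2 * ((1 + α) * σ2))) * ∑ i, (y i - θ i) ^ 2) * f y)
      (Set.Ico 0 β) := fun α hα => (key α hα).contDiffWithinAt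
  refine key2.congr fun α hα => ?_
  have hα1 : 0 < 1 + α := by linarith [hα.1]
  exact gpi_integral θ _ (by positivity) f
end

section
/- For alpha >= 0 let Risk_alpha(g) = E||theta - g(Y_alpha)||_2^2, where Y_alpha ~ N(theta, (1+alpha) sigma^2 I_n), theta is in R^n, sigma^2 > 0, and g : R^n -> R^n is measurable. If for some beta > 0 and integer k >= 0 one has E[ ||g(Y_beta)||_2^2 * ||Y_beta - theta||_2^{2m} ] < infinity for each m = 0, 1, ..., k, then the map alpha |-> Risk_alpha(g) is k times continuously differentiable on [0, beta). -/
open MeasureTheory ProbabilityTheory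

lemma gaussianPi_eq (n : ℕ) (θ : Fin n → ℝ) (v : ℝ) (hv : 0 < v) :
    gaussianPi n θ v = (volume : Measure (Fin n → ℝ)).withDensity (fun y => ENNReal.ofReal
      (((√(2 * Real.pi * v))⁻¹) ^ n * Real.exp (-(1 / (2 * v)) * ∑ i, (y i - θ i) ^ 2))) := by
  have hv' : v.toNNReal ≠ 0 := by simpa using hv
  have hf : ∀ y : Fin n → ℝ,
      ((√(2 * Real.pi * v))⁻¹) ^ n * Real.exp (-(1 / (2 * v)) * ∑ i, (y i - θ i) ^ 2)
      = ∏ i, gaussianPDFReal (θ i) v.toNNReal (y i) := by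
    intro y
    simp only [gaussianPDFReal, Finset.prod_mul_distrib, ← Real.exp_sum, Real.coe_toNNReal v hv.le]
    rw [Finset.mul_sum]
    simp only [Finset.prod_const, Finset.card_univ, Fintype.card_fin]
    congr 3
    ext i
    ring
  simp only [hf]
  unfold gaussianPi
  apply Measure.pi_eq
  intro s hs
  rw [withDensity_apply _ (MeasurableSet.univ_pi hs), volume_pi, Measure.restrict_pi_pi,
    ← ofReal_integral_eq_lintegral_ofReal]
  · rw [integral_fintype_prod_eq_prod, ENNReal.ofReal_prod_of_nonneg]
    · refine Finset.prod_congr rfl fun i _ => ?_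
      rw [gaussianReal_apply_eq_integral _ hv']
    · intro i _
      exact integral_nonneg fun x => gaussianPDFReal_nonneg _ _ _
  · exact Integrable.fintype_prod fun i => (integrable_gaussianPDFReal _ _).restrict
  · exact ae_of_all _ fun y => Finset.prod_nonneg fun i _ => gaussianPDFReal_nonneg _ _ _

/-- **Smoothness of the noise-elevated risk (Proposition 2).**
For `α ≥ 0` let `Risk_α(g) = E‖θ - g(Y_α)‖²` with `Y_α ~ N(θ, (1+α) σ² Iₙ)`.  If for some
`β > 0` and integer `k ≥ 0` one has `E[‖g(Y_β)‖² ‖Y_β - θ‖^{2m}] < ∞` for each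
`m = 0, …, k`, then `α ↦ Risk_α(g)` is `k` times continuously differentiable on `[0, β)`. -/
theorem risk_alpha_smooth
    {n : ℕ} (θ : Fin n → ℝ) (σ2 : ℝ) (hσ2 : 0 < σ2)
    (g : (Fin n → ℝ) → (Fin n → ℝ)) (hg : Measurable g)
    (β : ℝ) (hβ : 0 < β) (k : ℕ)
    (hmom : ∀ m : ℕ, m ≤ k →
      Integrable (fun y => (∑ i, (g y i) ^ 2) * (∑ i, (y i - θ i) ^ 2) ^ m)
        (gaussianPi n θ ((1 + β) * σ2))) :
    ContDiffOn ℝ k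
      (fun α : ℝ => ∫ y, ∑ i, (θ i - g y i) ^ 2 ∂(gaussianPi n θ ((1 + α) * σ2)))
      (Set.Ico 0 β) := by
  have hgi : ∀ i, Measurable fun y => g y i := fun i => (measurable_pi_apply i).comp hg
  set h : (Fin n → ℝ) → ℝ := fun y => ∑ i, (θ i - g y i) ^ 2 with hh
  set q : (Fin n → ℝ) → ℝ := fun y => ∑ i, (y i - θ i) ^ 2 with hq
  have hq0 : ∀ y, 0 ≤ q y := fun y => Finset.sum_nonneg fun i _ => sq_nonneg _
  have hh0 : ∀ y, 0 ≤ h y := fun y => Finset.sum_nonneg fun i _ => sq_nonneg _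
  have hqm : Measurable q := by fun_prop
  have hhm : Measurable h := by fun_prop
  set ν : Measure (Fin n → ℝ) := volume.withDensity fun y => ENNReal.ofReal (h y) with hν
  have hvpos : ∀ α : ℝ, 0 ≤ α → 0 < (1 + α) * σ2 := fun α ha => by positivity
  have hcpos : ∀ v : ℝ, 0 < v → 0 < (√(2 * Real.pi * v))⁻¹ ^ n := fun v hv => by positivity
  have hint : Integrable h (gaussianPi n θ ((1 + β) * σ2)) := by
    have : IsProbabilityMeasure (gaussianPi n θ ((1 + β) * σ2)) := by
      unfold gaussianPi; infer_instance
    have h0 := hmom 0 (Nat.zero_le _)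
    simp only [pow_zero, mul_one] at h0
    refine Integrable.mono' ((integrable_const (2 * ∑ i, θ i ^ 2)).add (h0.const_mul 2))
      hhm.aestronglyMeasurable (ae_of_all _ fun y => ?_)
    rw [Real.norm_of_nonneg (hh0 y)]
    simp only [hh, Pi.add_apply, Finset.mul_sum, ← Finset.sum_add_distrib]
    refine Finset.sum_le_sum fun i _ => ?_
    nlinarith [sq_nonneg (θ i + g y i)]
  have hmem : -(1 / (2 * ((1 + β) * σ2))) ∈ integrableExpSet q ν := by
    have hv := hvpos β hβ.le
    rw [gaussianPi_eq n θ _ hv, integrable_withDensity_iff (by fun_prop) (ae_of_all _ fun _ => ENNReal.ofReal_lt_top)] at hint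
    change Integrable _ ν
    rw [hν, integrable_withDensity_iff (by fun_prop) (ae_of_all _ fun _ => ENNReal.ofReal_lt_top)]
    have hc := hcpos _ hv
    refine (hint.const_mul (((√(2 * Real.pi * ((1 + β) * σ2)))⁻¹ ^ n)⁻¹)).congr
      (ae_of_all _ fun y => ?_)
    simp only
    rw [ENNReal.toReal_ofReal (hh0 y), ENNReal.toReal_ofReal (by positivity)]
    field_simp
    rfl
  have hsub : Set.Iic (-(1 / (2 * ((1 + β) * σ2)))) ⊆ integrableExpSet q ν := by
    intro t ht
    refine Integrable.mono' hmem (by fun_prop) (ae_of_all _ fun y => ?_)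
    rw [Real.norm_of_nonneg (Real.exp_pos _).le]
    exact Real.exp_le_exp.2 (mul_le_mul_of_nonneg_right ht (hq0 y))
  have hsub' : Set.Iio (-(1 / (2 * ((1 + β) * σ2)))) ⊆ interior (integrableExpSet q ν) := by
    rw [← interior_Iic]; exact interior_mono hsub
  have hrisk : ∀ α ∈ Set.Ico 0 β, (∫ y, h y ∂(gaussianPi n θ ((1 + α) * σ2)))
      = (√(2 * Real.pi * ((1 + α) * σ2)))⁻¹ ^ n * mgf q ν (-(1 / (2 * ((1 + α) * σ2)))) := by
    intro α ha
    have hv := hvpos α ha.1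
    have hc := hcpos _ hv
    rw [gaussianPi_eq n θ _ hv, mgf, hν,
      integral_withDensity_eq_integral_toReal_smul (by fun_prop) (ae_of_all _ fun _ => ENNReal.ofReal_lt_top),
      integral_withDensity_eq_integral_toReal_smul (by fun_prop) (ae_of_all _ fun _ => ENNReal.ofReal_lt_top), ← integral_const_mul]
    congr 1
    ext y
    rw [ENNReal.toReal_ofReal (hh0 y), ENNReal.toReal_ofReal (by positivity)]
    simp only [smul_eq_mul, hq]
    ring
  refine ContDiffOn.congr ?_ hrisk
  intro α ha
  have hv := hvpos α ha.1
  apply ContDiffAt.contDiffWithinAt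
  have h1 : ContDiffAt ℝ k (mgf q ν) (-(1 / (2 * ((1 + α) * σ2)))) := by
    refine (analyticAt_mgf (hsub' ?_)).contDiffAt
    have := ha.2
    simp only [Set.mem_Iio, neg_lt_neg_iff]
    gcongr
  have h2 : ContDiffAt ℝ k (fun α : ℝ => -(1 / (2 * ((1 + α) * σ2)))) α := by
    refine (ContDiffAt.div (by fun_prop) (by fun_prop) (by positivity)).neg
  refine ContDiffAt.mul (ContDiffAt.pow (ContDiffAt.inv (ContDiffAt.sqrt (by fun_prop) ?_) ?_) n)
    (ContDiffAt.comp (g := mgf q ν) (f := fun α : ℝ => -(1 / (2 * ((1 + α) * σ2)))) α h1 h2)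
  · positivity
  · positivity
end

section
/- Let Y ~ N(theta, sigma^2 I_n) with theta in R^n and sigma^2 > 0, and let omega ~ N(0, sigma^2 I_n) be independent of Y. Let g : R^n -> R^n be continuously differentiable, and suppose there is beta > 0 such that E||g(Y_beta)||_2^2 < infinity and E|partial_i g_i(Y_beta)| < infinity for i = 1, ..., n, where Y_beta ~ N(theta, (1+beta) sigma^2 I_n). For alpha > 0 define the infinite-bootstrap coupled bootstrap estimator CB_alpha^infty(g) = E[ ||Y - omega/sqrt(alpha) - g(Y + sqrt(alpha) omega)||_2^2 - ||omega||_2^2 / alpha | Y ] - n sigma^2. Then, almost surely, lim_{alpha -> 0} CB_alpha^infty(g) = ||Y - g(Y)||_2^2 + 2 sigma^2 * (div g)(Y) - n sigma^2 = SURE(g). -/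
open MeasureTheory ProbabilityTheory Filter

instance gaussianPi_prob (n : ℕ) (m : Fin n → ℝ) (v : ℝ) : IsProbabilityMeasure (gaussianPi n m v) := by
  unfold gaussianPi; infer_instance

lemma pi_withDensity_aux {n : ℕ} (ρ : Fin n → Measure ℝ) [∀ i, IsProbabilityMeasure (ρ i)]
    (f : Fin n → ℝ → ENNReal) (hf : ∀ i, Measurable (f i))
    [∀ i, SigmaFinite ((ρ i).withDensity (f i))] :
    Measure.pi (fun i => (ρ i).withDensity (f i))
      = (Measure.pi ρ).withDensity (fun x => ∏ i, f i (x i)) := by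
  refine Measure.pi_eq (fun s hs => ?_)
  rw [withDensity_apply _ (MeasurableSet.univ_pi hs), ← lintegral_indicator (MeasurableSet.univ_pi hs)]
  have h1 : ∀ x : Fin n → ℝ, (Set.univ.pi s).indicator (fun x => ∏ i, f i (x i)) x
      = ∏ i, (s i).indicator (f i) (x i) := by
    intro x
    by_cases hx : x ∈ Set.univ.pi s
    · rw [Set.indicator_of_mem hx]
      refine Finset.prod_congr rfl fun i _ => ?_
      rw [Set.indicator_of_mem (hx i trivial)]
    · rw [Set.indicator_of_notMem hx]
      simp only [Set.mem_pi, not_forall] at hx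
      obtain ⟨i, _, hi⟩ := hx
      symm
      exact Finset.prod_eq_zero (Finset.mem_univ i) (Set.indicator_of_notMem hi _)
  simp_rw [h1]
  have hm : ∀ i, Measurable ((s i).indicator (f i)) := fun i => (hf i).indicator (hs i)
  have h2 := iIndepFun_pi (μ := ρ) (X := fun i => (s i).indicator (f i))
    (fun i => (hm i).aemeasurable)
  rw [lintegral_prod_eq_prod_lintegral_of_indepFun Finset.univ
    (fun i (x : Fin n → ℝ) => (s i).indicator (f i) (x i)) h2 (fun i => (hm i).comp (measurable_pi_apply i))]
  refine Finset.prod_congr rfl fun i _ => ?_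
  rw [withDensity_apply _ (hs i), ← lintegral_indicator (hs i)]
  exact (measurePreserving_eval ρ i).lintegral_comp (hm i)

lemma gaussianReal_ratio (y θ : ℝ) {s v : NNReal} (hs : s ≠ 0) (hv : v ≠ 0) :
    gaussianReal y s = (gaussianReal θ v).withDensity
      (fun x => ENNReal.ofReal (gaussianPDFReal y s x / gaussianPDFReal θ v x)) := by
  rw [gaussianReal_of_var_ne_zero y hs, gaussianReal_of_var_ne_zero θ hv, ← withDensity_mul]
  · congr 1
    ext x
    have := gaussianPDFReal_pos θ v x hv
    simp only [Pi.mul_apply, gaussianPDF]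
    rw [← ENNReal.ofReal_mul this.le, mul_div_cancel₀ _ this.ne']
  · exact measurable_gaussianPDF _ _
  · exact ((measurable_gaussianPDFReal _ _).div (measurable_gaussianPDFReal _ _)).ennreal_ofReal

lemma gaussianPDF_ratio_le (y θ x : ℝ) {s v : ℝ} (hs : 0 < s) (hv : 0 < v) (hsv : 4 * s ≤ v) :
    gaussianPDFReal y s.toNNReal x / gaussianPDFReal θ v.toNNReal x
      ≤ Real.sqrt (v / s) * Real.exp ((y - θ) ^ 2 / v) * Real.exp (-(x - y) ^ 2 / (4 * s)) := by
  have hpos := gaussianPDFReal_pos θ v.toNNReal x (by simpa using hv)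
  rw [div_le_iff₀ hpos]
  simp only [gaussianPDFReal, Real.coe_toNNReal _ hs.le, Real.coe_toNNReal _ hv.le]
  have e1 : (Real.sqrt (2 * Real.pi * s))⁻¹ = Real.sqrt (v / s) * (Real.sqrt (2 * Real.pi * v))⁻¹ := by
    have : (0:ℝ) < 2 * Real.pi * v := by positivity
    have h3 : (0:ℝ) < 2 * Real.pi * s := by positivity
    rw [← Real.sqrt_inv, ← Real.sqrt_inv, ← Real.sqrt_mul (by positivity)]
    congr 1
    field_simp
  rw [e1]
  have e2 : Real.exp (-(x - y) ^ 2 / (2 * s)) ≤ Real.exp ((y - θ) ^ 2 / v) * Real.exp (-(x - y) ^ 2 / (4 * s)) * Real.exp (-(x - θ) ^ 2 / (2 * v)) := by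
    rw [← Real.exp_add, ← Real.exp_add]
    apply Real.exp_le_exp.mpr
    have h1 : (x - θ) ^ 2 / (2 * v) ≤ (x - y) ^ 2 / v + (y - θ) ^ 2 / v := by
      rw [← add_div, div_le_div_iff₀ (by positivity) hv]
      nlinarith [sq_nonneg ((x - y) - (y - θ)), mul_nonneg hv.le (sq_nonneg ((x - y) - (y - θ)))]
    have h2 : (x - y) ^ 2 / v ≤ (x - y) ^ 2 / (4 * s) :=
      div_le_div_of_nonneg_left (sq_nonneg _) (by positivity) hsv
    have h3 : (x - y) ^ 2 / (2 * s) = 2 * ((x - y) ^ 2 / (4 * s)) := by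
      field_simp; norm_num
    rw [neg_div, neg_div, neg_div, h3]
    linarith
  have hc : 0 ≤ Real.sqrt (v / s) * (Real.sqrt (2 * Real.pi * v))⁻¹ := by positivity
  calc _ ≤ _ := mul_le_mul_of_nonneg_left e2 hc
    _ = _ := by ring

lemma gaussianPi_restrict_le {n : ℕ} (y θ : Fin n → ℝ) {s v δ : ℝ} (hs : 0 < s) (hv : 0 < v)
    (hsv : 4 * s ≤ v) (hδ : 0 < δ) :
    (gaussianPi n y s).restrict {x | δ ≤ ‖x - y‖} ≤
      ENNReal.ofReal (Real.sqrt (v / s) ^ n * Real.exp (∑ i, (y i - θ i) ^ 2 / v)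
        * Real.exp (-δ ^ 2 / (4 * s))) • gaussianPi n θ v := by
  have hs' : s.toNNReal ≠ 0 := by simpa using hs
  have hv' : v.toNNReal ≠ 0 := by simpa using hv
  have hS : MeasurableSet {x : Fin n → ℝ | δ ≤ ‖x - y‖} :=
    measurableSet_le measurable_const (by fun_prop)
  have hr : ∀ i, gaussianReal (y i) s.toNNReal = (gaussianReal (θ i) v.toNNReal).withDensity
      (fun x => ENNReal.ofReal (gaussianPDFReal (y i) s.toNNReal x / gaussianPDFReal (θ i) v.toNNReal x)) :=
    fun i => gaussianReal_ratio _ _ hs' hv'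
  have hE : gaussianPi n y s = (gaussianPi n θ v).withDensity (fun x => ∏ i,
      ENNReal.ofReal (gaussianPDFReal (y i) s.toNNReal (x i) / gaussianPDFReal (θ i) v.toNNReal (x i))) := by
    have : ∀ i, SigmaFinite ((gaussianReal (θ i) v.toNNReal).withDensity
      (fun x => ENNReal.ofReal (gaussianPDFReal (y i) s.toNNReal x / gaussianPDFReal (θ i) v.toNNReal x))) := by
      intro i; rw [← hr i]; infer_instance
    unfold gaussianPi
    rw [← pi_withDensity_aux (fun i => gaussianReal (θ i) v.toNNReal) (fun i x => ENNReal.ofReal (gaussianPDFReal (y i) s.toNNReal x / gaussianPDFReal (θ i) v.toNNReal x))]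
    · congr 1
      ext1 i
      exact hr i
    · intro i
      exact ((measurable_gaussianPDFReal _ _).div (measurable_gaussianPDFReal _ _)).ennreal_ofReal
  rw [hE, restrict_withDensity hS, ← withDensity_indicator hS, ← withDensity_const]
  refine withDensity_mono (Eventually.of_forall fun x => ?_)
  by_cases hx : x ∈ {x : Fin n → ℝ | δ ≤ ‖x - y‖}
  swap
  · rw [Set.indicator_of_notMem hx]
    exact zero_le
  rw [Set.indicator_of_mem hx]
  rw [← ENNReal.ofReal_prod_of_nonneg (fun i _ => div_nonneg (gaussianPDFReal_nonneg _ _ _) (gaussianPDFReal_nonneg _ _ _))]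
  apply ENNReal.ofReal_le_ofReal
  refine (Finset.prod_le_prod (fun i _ => div_nonneg (gaussianPDFReal_nonneg _ _ _) (gaussianPDFReal_nonneg _ _ _)) (fun i _ => gaussianPDF_ratio_le (y i) (θ i) (x i) hs hv hsv)).trans ?_
  rw [Finset.prod_mul_distrib, Finset.prod_mul_distrib, ← Real.exp_sum, ← Real.exp_sum]
  simp only [Finset.prod_const, Finset.card_univ, Fintype.card_fin]
  gcongr
  rw [← Finset.sum_div]
  gcongr
  rw [Finset.sum_neg_distrib, neg_le_neg_iff]
  have hx' : δ ≤ ‖x - y‖ := hx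
  have : ∃ i, δ ≤ ‖(x - y) i‖ := by
    by_contra! h
    exact absurd ((pi_norm_lt_iff hδ).mpr h) (not_lt.mpr hx')
  obtain ⟨i, hi⟩ := this
  calc δ ^ 2 ≤ ‖(x - y) i‖ ^ 2 := by gcongr
    _ = (x i - y i) ^ 2 := by simp
    _ ≤ _ := Finset.single_le_sum (f := fun i => (x i - y i) ^ 2) (fun i _ => sq_nonneg _) (Finset.mem_univ i)

lemma gaussianPi_map {n : ℕ} (y : Fin n → ℝ) (s a : ℝ) :
    (gaussianPi n 0 s).map (fun w j => y j + a * w j) = gaussianPi n y (a ^ 2 * s) := by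
  unfold gaussianPi
  have h : ∀ i, (gaussianReal ((0 : Fin n → ℝ) i) s.toNNReal).map (fun x => y i + a * x) = gaussianReal (y i) (a ^ 2 * s).toNNReal := by
    intro i
    have := gaussianReal_map_const_add (μ := a * 0) (v := .mk (a ^ 2) (sq_nonneg _) * s.toNNReal) (y i)
    rw [← gaussianReal_map_const_mul, Measure.map_map (by fun_prop) (by fun_prop)] at this
    simp only [Pi.zero_apply]
    have e0 : (fun x => y i + a * x) = (fun x => y i + x) ∘ fun x => a * x := rfl
    rw [e0, this]
    congr 1
    · ring
    · rw [Real.toNNReal_mul (sq_nonneg _)]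
      congr 1
      ext; simp [sq_nonneg]
  have : ∀ i, SigmaFinite ((gaussianReal ((0 : Fin n → ℝ) i) s.toNNReal).map (fun x => y i + a * x)) := by
    intro i; rw [h]; infer_instance
  have h2 := Measure.pi_map_pi (μ := fun i => gaussianReal ((0 : Fin n → ℝ) i) s.toNNReal) (f := fun i x => y i + a * x) (fun i => by fun_prop)
  rw [h2]
  congr 1
  ext1 i
  exact h i

lemma eps_tendsto (n k : ℕ) {v s δ : ℝ} (K : ℝ) (hv : 0 < v) (hs : 0 < s) (hδ : 0 < δ) :
    Tendsto (fun a : ℝ => (a ^ k)⁻¹ * (Real.sqrt (v / (a ^ 2 * s)) ^ n * K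
        * Real.exp (-δ ^ 2 / (4 * (a ^ 2 * s))))) (nhdsWithin 0 (Set.Ioi 0)) (nhds 0) := by
  have h0 : Tendsto (fun t : ℝ => t ^ (k + n) * Real.exp (-t)) atTop (nhds 0) :=
    Real.tendsto_pow_mul_exp_neg_atTop_nhds_zero (k + n)
  have h1 : Tendsto (fun t : ℝ => t ^ (k + n) * Real.exp (-(δ ^ 2 / (4 * s)) * t ^ 2)) atTop (nhds 0) := by
    refine squeeze_zero' ?_ ?_ h0
    · filter_upwards [eventually_ge_atTop 0] with t ht using by positivity
    · filter_upwards [eventually_ge_atTop 0, eventually_ge_atTop (1 / (δ ^ 2 / (4 * s)))] with t ht ht2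
      gcongr
      have : 0 < δ ^ 2 / (4 * s) := by positivity
      rw [div_le_iff₀ this] at ht2
      nlinarith
  have h2 := (h1.comp tendsto_inv_nhdsGT_zero).const_mul (Real.sqrt (v / s) ^ n * K)
  rw [mul_zero] at h2
  refine h2.congr' ?_
  filter_upwards [self_mem_nhdsWithin] with a ha
  have ha : 0 < a := ha
  have e1 : Real.sqrt (v / (a ^ 2 * s)) = Real.sqrt (v / s) * a⁻¹ := by
    rw [show v / (a ^ 2 * s) = (v / s) * (a⁻¹) ^ 2 by field_simp, Real.sqrt_mul (by positivity), Real.sqrt_sq (by positivity)]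
  have e2 : -δ ^ 2 / (4 * (a ^ 2 * s)) = -(δ ^ 2 / (4 * s)) * a⁻¹ ^ 2 := by field_simp
  simp only [Function.comp]
  rw [e1, e2, mul_pow, pow_add, inv_pow]
  ring

lemma limit_aux {n : ℕ} (y θ : Fin n → ℝ) {s v δ : ℝ} (hs : 0 < s) (hv : 0 < v) (hδ : 0 < δ)
    (h : (Fin n → ℝ) → ℝ) (hc : Continuous h) (hint : Integrable h (gaussianPi n θ v)) (k : ℕ)
    (B : (Fin n → ℝ) → ℝ) (hBi : Integrable B (gaussianPi n 0 s)) (hB0 : ∀ w, 0 ≤ B w)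
    (hB : ∀ a : ℝ, 0 < a → ∀ w : Fin n → ℝ, ‖a • w‖ < δ →
      |(a ^ k)⁻¹ * h (fun j => y j + a * w j)| ≤ B w)
    (l : (Fin n → ℝ) → ℝ)
    (hl : ∀ w : Fin n → ℝ, Tendsto (fun a : ℝ => (a ^ k)⁻¹ * h (fun j => y j + a * w j))
      (nhdsWithin 0 (Set.Ioi 0)) (nhds (l w))) :
    (∀ᶠ a in nhdsWithin (0:ℝ) (Set.Ioi 0),
      Integrable (fun w => (a ^ k)⁻¹ * h (fun j => y j + a * w j)) (gaussianPi n 0 s)) ∧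
    Tendsto (fun a : ℝ => ∫ w, (a ^ k)⁻¹ * h (fun j => y j + a * w j) ∂(gaussianPi n 0 s))
      (nhdsWithin 0 (Set.Ioi 0)) (nhds (∫ w, l w ∂(gaussianPi n 0 s))) := by
  set ν := gaussianPi n 0 s with hν
  set S : Set (Fin n → ℝ) := {x | δ ≤ ‖x - y‖} with hSdef
  have hS : MeasurableSet S := measurableSet_le measurable_const (by fun_prop)
  let R : ℝ → Set (Fin n → ℝ) := fun a => {w | δ ≤ ‖a • w‖}
  have hR : ∀ a, MeasurableSet (R a) := fun a => measurableSet_le measurable_const (by fun_prop)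
  let f : ℝ → (Fin n → ℝ) → ℝ := fun a w => (a ^ k)⁻¹ * h (fun j => y j + a * w j)
  have hfc : ∀ a, Continuous (f a) := fun a => by
    apply Continuous.mul continuous_const
    apply hc.comp
    fun_prop
  have hT : ∀ a : ℝ, Measurable (fun (w : Fin n → ℝ) j => y j + a * w j) := fun a => by fun_prop
  have hRS : ∀ a : ℝ, R a = (fun (w : Fin n → ℝ) j => y j + a * w j) ⁻¹' S := by
    intro a
    ext w
    simp only [R, hSdef, Set.mem_ofPred_eq, Set.mem_preimage]
    have : (fun j => y j + a * w j) - y = a • w := by ext j; simp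
    rw [this]
  set ε : ℝ → ℝ := fun a => Real.sqrt (v / (a ^ 2 * s)) ^ n * Real.exp (∑ i, (y i - θ i) ^ 2 / v)
        * Real.exp (-δ ^ 2 / (4 * (a ^ 2 * s))) with hε
  have hε0 : ∀ a, 0 ≤ ε a := fun a => by positivity
  have hle : ∀ᶠ a in nhdsWithin (0:ℝ) (Set.Ioi 0),
      0 < a ∧ (gaussianPi n y (a ^ 2 * s)).restrict S ≤ ENNReal.ofReal (ε a) • gaussianPi n θ v := by
    have h1 : Tendsto (fun a : ℝ => 4 * (a ^ 2 * s)) (nhdsWithin 0 (Set.Ioi 0)) (nhds 0) := by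
      have : Continuous (fun a : ℝ => 4 * (a ^ 2 * s)) := by fun_prop
      have := (this.tendsto 0).mono_left (nhdsWithin_le_nhds (s := Set.Ioi 0))
      simpa using this
    filter_upwards [h1.eventually (gt_mem_nhds hv), self_mem_nhdsWithin] with a ha ha0
    have ha0 : 0 < a := ha0
    exact ⟨ha0, gaussianPi_restrict_le y θ (by positivity) hv ha.le hδ⟩
  have hmapR : ∀ a, (ν.restrict (R a)).map (fun (w : Fin n → ℝ) j => y j + a * w j)
      = (gaussianPi n y (a ^ 2 * s)).restrict S := by
    intro a
    rw [hRS, ← Measure.restrict_map (hT a) hS, hν, gaussianPi_map]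
  have hfar : ∀ᶠ a in nhdsWithin (0:ℝ) (Set.Ioi 0), IntegrableOn (f a) (R a) ν ∧
      ‖∫ w in R a, f a w ∂ν‖ ≤ (a ^ k)⁻¹ * ε a * ∫ x, |h x| ∂(gaussianPi n θ v) := by
    filter_upwards [hle] with a ⟨ha0, ha⟩
    have hI : Integrable h (ENNReal.ofReal (ε a) • gaussianPi n θ v) :=
      hint.smul_measure ENNReal.ofReal_ne_top
    have hI2 := hI.mono_measure ha
    have hI3 : Integrable (fun w => h (fun j => y j + a * w j)) (ν.restrict (R a)) := by
      rw [← hmapR] at hI2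
      exact hI2.comp_measurable (hT a)
    refine ⟨hI3.const_mul _, ?_⟩
    have e1 : ∫ w in R a, f a w ∂ν = (a ^ k)⁻¹ * ∫ x in S, h x ∂(gaussianPi n y (a ^ 2 * s)) := by
      simp only [f]
      rw [integral_const_mul, ← hmapR, integral_map (hT a).aemeasurable hc.aestronglyMeasurable]
    rw [e1, norm_mul, Real.norm_of_nonneg (by positivity : 0 ≤ (a ^ k)⁻¹), mul_assoc]
    gcongr
    refine (norm_integral_le_integral_norm _).trans ?_
    refine (integral_mono_measure ha (Eventually.of_forall fun x => norm_nonneg _) hI.norm).trans ?_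
    rw [integral_smul_measure, ENNReal.toReal_ofReal (hε0 a)]
    simp
  have hnearI : ∀ a, 0 < a → IntegrableOn (f a) (R a)ᶜ ν := by
    intro a ha
    refine Integrable.mono' hBi.integrableOn (hfc a).aestronglyMeasurable ?_
    filter_upwards [ae_restrict_mem (hR a).compl] with w hw
    exact hB a ha w (not_le.mp hw)
  have hInt : ∀ᶠ a in nhdsWithin (0:ℝ) (Set.Ioi 0), Integrable (f a) ν := by
    filter_upwards [hfar, self_mem_nhdsWithin] with a ha ha0
    rw [← integrableOn_univ, ← Set.union_compl_self (R a)]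
    exact ha.1.union (hnearI a ha0)
  refine ⟨hInt, ?_⟩
  have hfarT : Tendsto (fun a => ∫ w in R a, f a w ∂ν) (nhdsWithin (0:ℝ) (Set.Ioi 0)) (nhds 0) := by
    have h1 := (eps_tendsto n k (Real.exp (∑ i, (y i - θ i) ^ 2 / v)) hv hs hδ).mul_const
      (∫ x, |h x| ∂(gaussianPi n θ v))
    rw [zero_mul] at h1
    exact squeeze_zero_norm' (hfar.mono fun a ha => ha.2) h1
  have hnearT : Tendsto (fun a => ∫ w in (R a)ᶜ, f a w ∂ν) (nhdsWithin (0:ℝ) (Set.Ioi 0))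
      (nhds (∫ w, l w ∂ν)) := by
    have : ∀ a, ∫ w in (R a)ᶜ, f a w ∂ν = ∫ w, (R a)ᶜ.indicator (f a) w ∂ν :=
      fun a => (integral_indicator (hR a).compl).symm
    simp_rw [this]
    refine tendsto_integral_filter_of_dominated_convergence B ?_ ?_ hBi ?_
    · exact Eventually.of_forall fun a => (hfc a).aestronglyMeasurable.indicator (hR a).compl
    · filter_upwards [self_mem_nhdsWithin] with a ha
      refine Eventually.of_forall fun w => ?_
      by_cases hw : w ∈ (R a)ᶜ
      · rw [Set.indicator_of_mem hw]
        exact hB a ha w (not_le.mp hw)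
      · rw [Set.indicator_of_notMem hw, norm_zero]
        exact hB0 w
    · refine Eventually.of_forall fun w => ?_
      refine (hl w).congr' ?_
      have h1 : Tendsto (fun a : ℝ => ‖a • w‖) (nhdsWithin 0 (Set.Ioi 0)) (nhds 0) := by
        have : Continuous (fun a : ℝ => ‖a • w‖) := by fun_prop
        have := (this.tendsto 0).mono_left (nhdsWithin_le_nhds (s := Set.Ioi 0))
        simpa using this
      filter_upwards [h1.eventually (gt_mem_nhds hδ)] with a ha
      rw [Set.indicator_of_mem]
      exact not_le.mpr ha
  have := hfarT.add hnearT
  rw [zero_add] at this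
  refine this.congr' ?_
  filter_upwards [hInt] with a ha
  exact integral_add_compl (hR a) ha

lemma gp_memLp_s7 {n : ℕ} (m : Fin n → ℝ) (v : ℝ) (i : Fin n) :
    MemLp (fun w : Fin n → ℝ => w i) 2 (gaussianPi n m v) :=
  (memLp_id_gaussianReal' (μ := m i) (v := v.toNNReal) 2 (by simp)).comp_measurePreserving
    (measurePreserving_eval (fun i => gaussianReal (m i) v.toNNReal) i)

lemma gp_mean_s7 {n : ℕ} (v : ℝ) (i : Fin n) : ∫ w, w i ∂(gaussianPi n 0 v) = 0 := by
  have := integral_eval (μ := fun i => gaussianReal ((0 : Fin n → ℝ) i) v.toNNReal) (i := i)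
  unfold gaussianPi
  rw [this]
  simp

lemma gp_cov_s7 {n : ℕ} {v : ℝ} (hv : 0 < v) (i j : Fin n) :
    ∫ w, w i * w j ∂(gaussianPi n 0 v) = if i = j then v else 0 := by
  split_ifs with hij
  · subst hij
    have := integral_comp_eval (μ := fun i => gaussianReal ((0 : Fin n → ℝ) i) v.toNNReal) (i := i)
      (f := fun x : ℝ => x * x) (by fun_prop)
    unfold gaussianPi
    rw [this]
    have h2 := variance_fun_id_gaussianReal (μ := 0) (v := v.toNNReal)
    rw [variance_of_integral_eq_zero (by fun_prop) (by simp)] at h2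
    simp only [Real.coe_toNNReal _ hv.le] at h2
    simpa [pow_two] using h2
  · have h2 := iIndepFun_pi (μ := fun i => gaussianReal ((0 : Fin n → ℝ) i) v.toNNReal)
      (X := fun i x => x) (fun i => by fun_prop)
    have h3 := (h2.indepFun hij).integral_fun_mul_eq_mul_integral (measurable_pi_apply i).aestronglyMeasurable
      (measurable_pi_apply j).aestronglyMeasurable
    have h4 := gp_mean_s7 v i
    unfold gaussianPi at h4 ⊢
    rw [h3, h4, zero_mul]

lemma lim_one {n : ℕ} (y θ : Fin n → ℝ) {s v : ℝ} (hs : 0 < s) (hv : 0 < v)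
    (h : (Fin n → ℝ) → ℝ) (hc : Continuous h) (hint : Integrable h (gaussianPi n θ v)) :
    (∀ᶠ a in nhdsWithin (0:ℝ) (Set.Ioi 0),
      Integrable (fun w => h (fun j => y j + a * w j)) (gaussianPi n 0 s)) ∧
    Tendsto (fun a : ℝ => ∫ w, h (fun j => y j + a * w j) ∂(gaussianPi n 0 s))
      (nhdsWithin 0 (Set.Ioi 0)) (nhds (h y)) := by
  obtain ⟨δ, hδ, hd⟩ := Metric.continuous_iff.mp hc y 1 one_pos
  have := limit_aux y θ hs hv hδ h hc hint 0 (fun _ => |h y| + 1) (integrable_const _)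
    (fun w => by positivity) ?_ (fun _ => h y) ?_
  · simpa using this
  · intro a ha w hw
    have h1 := hd (fun j => y j + a * w j) (by
      rw [dist_eq_norm]
      have hx : (fun j => y j + a * w j) - y = a • w := by ext j; simp
      rw [hx]
      exact hw)
    rw [Real.dist_eq] at h1
    simp only [pow_zero, inv_one, one_mul]
    have := abs_sub_abs_le_abs_sub (h (fun j => y j + a * w j)) (h y)
    linarith
  · intro w
    have : Continuous (fun a : ℝ => (a ^ 0)⁻¹ * h (fun j => y j + a * w j)) := by
      simp only [pow_zero, inv_one, one_mul]
      exact hc.comp (by fun_prop)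
    have := (this.tendsto 0).mono_left (nhdsWithin_le_nhds (s := Set.Ioi 0))
    simpa using this

lemma lim_two {n : ℕ} (y θ : Fin n → ℝ) {s v : ℝ} (hs : 0 < s) (hv : 0 < v)
    (f : (Fin n → ℝ) → ℝ) (hc : Continuous f) (L : (Fin n → ℝ) →L[ℝ] ℝ) (hL : HasFDerivAt f L y)
    (hf : MemLp f 2 (gaussianPi n θ v)) (i : Fin n) :
    (∀ᶠ a in nhdsWithin (0:ℝ) (Set.Ioi 0),
      Integrable (fun w => a⁻¹ * (w i * (f (fun j => y j + a * w j) - f y))) (gaussianPi n 0 s)) ∧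
    Tendsto (fun a : ℝ => ∫ w, a⁻¹ * (w i * (f (fun j => y j + a * w j) - f y)) ∂(gaussianPi n 0 s))
      (nhdsWithin 0 (Set.Ioi 0)) (nhds (s * L (Pi.single i 1))) := by
  obtain ⟨C, hC0, hC⟩ := hL.isBigO_sub.exists_nonneg
  obtain ⟨δ, hδ, hd⟩ := Metric.eventually_nhds_iff.mp hC.bound
  have hint : Integrable (fun x : Fin n → ℝ => (x i - y i) * (f x - f y)) (gaussianPi n θ v) :=
    ((gp_memLp_s7 θ v i).sub (memLp_const (y i))).integrable_mul (hf.sub (memLp_const (f y)))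
  have hcov : ∀ j, Integrable (fun w : Fin n → ℝ => w i * w j) (gaussianPi n 0 s) := fun j =>
    (gp_memLp_s7 0 s i).integrable_mul (gp_memLp_s7 0 s j)
  have hLw : ∀ w, w i * L w = ∑ j, (w i * w j) * L (Pi.single j 1) := by
    intro w
    conv_lhs => rw [pi_eq_sum_univ' w]
    rw [map_sum, Finset.mul_sum]
    refine Finset.sum_congr rfl fun j _ => ?_
    have : (fun k => if j = k then (1:ℝ) else 0) = Pi.single j 1 := by
      ext k; simp [Pi.single_apply, eq_comm]
    rw [map_smul, smul_eq_mul, mul_assoc]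
    simp [this, Pi.single_apply]
  have key := limit_aux y θ hs hv hδ (fun x => (x i - y i) * (f x - f y)) (by fun_prop) hint 2
    (fun w => C * ∑ j, (w j) ^ 2)
    ((integrable_finsetSum _ fun j _ => (gp_memLp_s7 0 s j).integrable_sq).const_mul C)
    (fun w => mul_nonneg hC0 (Finset.sum_nonneg fun j _ => sq_nonneg _)) ?_ (fun w => w i * L w) ?_
  · have e : ∫ w, w i * L w ∂(gaussianPi n 0 s) = s * L (Pi.single i 1) := by
      simp_rw [hLw]
      rw [integral_finsetSum _ fun j _ => (hcov j).mul_const _]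
      simp_rw [integral_mul_const, gp_cov_s7 hs]
      simp
    rw [e] at key
    have e2 : ∀ a : ℝ, 0 < a → ∀ w : Fin n → ℝ,
        (a ^ 2)⁻¹ * ((y i + a * w i - y i) * (f (fun j => y j + a * w j) - f y))
        = a⁻¹ * (w i * (f (fun j => y j + a * w j) - f y)) := by
      intro a ha w
      field_simp
      ring
    refine ⟨?_, ?_⟩
    · filter_upwards [key.1, self_mem_nhdsWithin] with a ha ha0
      exact ha.congr (Eventually.of_forall (e2 a ha0))
    · refine key.2.congr' ?_
      filter_upwards [self_mem_nhdsWithin] with a ha0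
      exact integral_congr_ae (Eventually.of_forall (e2 a ha0))
  · intro a ha w hw
    have hx : (fun j => y j + a * w j) - y = a • w := by ext j; simp
    have h1 := hd (y := fun j => y j + a * w j) (by rw [dist_eq_norm, hx]; exact hw)
    rw [hx, norm_smul, Real.norm_eq_abs, Real.norm_eq_abs, abs_of_pos ha] at h1
    have h2 : |w i| ≤ ‖w‖ := norm_le_pi_norm w i
    have h3 : ‖w‖ ^ 2 ≤ ∑ j, (w j) ^ 2 := by
      have hn : ‖w‖ ≤ Real.sqrt (∑ j, (w j) ^ 2) := by
        rw [pi_norm_le_iff_of_nonneg (Real.sqrt_nonneg _)]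
        intro j
        apply Real.le_sqrt_of_sq_le
        rw [Real.norm_eq_abs, sq_abs]
        exact Finset.single_le_sum (f := fun j => (w j) ^ 2) (fun _ _ => sq_nonneg _) (Finset.mem_univ j)
      calc ‖w‖ ^ 2 ≤ Real.sqrt (∑ j, (w j) ^ 2) ^ 2 := by gcongr
        _ = _ := Real.sq_sqrt (Finset.sum_nonneg fun _ _ => sq_nonneg _)
    have e3 : y i + a * w i - y i = a * w i := by ring
    rw [e3, abs_mul, abs_mul, abs_mul, abs_of_pos ha, abs_of_pos (by positivity : 0 < (a ^ 2)⁻¹)]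
    calc (a ^ 2)⁻¹ * (a * |w i| * |f (fun j => y j + a * w j) - f y|)
        ≤ (a ^ 2)⁻¹ * (a * ‖w‖ * (C * (a * ‖w‖))) := by gcongr
      _ = C * ‖w‖ ^ 2 := by field_simp
      _ ≤ _ := by gcongr
  · intro w
    have hline : HasDerivAt (fun t : ℝ => f (y + t • w)) (L w) 0 := hL.hasLineDerivAt w
    have h1 := (hline.tendsto_slope_zero_right).const_mul (w i)
    refine h1.congr' ?_
    filter_upwards [self_mem_nhdsWithin] with a ha
    have ha : 0 < a := ha
    have hx : (fun j => y j + a * w j) = y + a • w := by ext j; simp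
    simp only [hx, zero_add, zero_smul, add_zero, smul_eq_mul, Pi.add_apply, Pi.smul_apply]
    field_simp
    ring

/-- **Noiseless limit of the infinite-bootstrap coupled bootstrap estimator (Theorem 2,
smooth case).**  Let `Y ~ N(θ, σ² Iₙ)` and `ω ~ N(0, σ² Iₙ)` independent of `Y`.  For a
continuously differentiable `g` whose moment conditions hold at an elevated noise level
`(1+β) σ²`, the infinite-bootstrap coupled bootstrap estimator
`CB_α^∞(g) = E[‖Y - ω/√α - g(Y + √α ω)‖² - ‖ω‖²/α | Y] - n σ²` converges almost surely, as
`α → 0⁺`, to `SURE(g) = ‖Y - g(Y)‖² + 2 σ² (div g)(Y) - n σ²`.  (The conditional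
expectation given `Y` is written as the integral over the law of `ω`.) -/
theorem cb_infinite_bootstrap_noiseless_limit
    {n : ℕ} (θ : Fin n → ℝ) (σ2 : ℝ) (hσ2 : 0 < σ2)
    (g : (Fin n → ℝ) → (Fin n → ℝ)) (hg : ContDiff ℝ 1 g)
    (β : ℝ) (hβ : 0 < β)
    (hg2 : Integrable (fun y => ∑ i, (g y i) ^ 2) (gaussianPi n θ ((1 + β) * σ2)))
    (hdiv : ∀ i, Integrable (fun y => fderiv ℝ g y (Pi.single i 1) i)
      (gaussianPi n θ ((1 + β) * σ2))) :
    ∀ᵐ y ∂(gaussianPi n θ σ2),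
      Tendsto (fun α : ℝ =>
          (∫ w, ((∑ i, (y i - w i / Real.sqrt α
              - g (fun j => y j + Real.sqrt α * w j) i) ^ 2)
            - (∑ i, (w i) ^ 2) / α) ∂(gaussianPi n 0 σ2)) - n * σ2)
        (nhdsWithin 0 (Set.Ioi 0))
        (nhds ((∑ i, (y i - g y i) ^ 2)
          + 2 * σ2 * (∑ i, fderiv ℝ g y (Pi.single i 1) i) - n * σ2)) := by
  refine Eventually.of_forall fun y => ?_
  have hv : 0 < (1 + β) * σ2 := by positivity
  have hgc : ∀ i, Continuous (fun x => g x i) := fun i => (continuous_apply i).comp hg.continuous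
  have hmem : ∀ i, MemLp (fun x => g x i) 2 (gaussianPi n θ ((1 + β) * σ2)) := by
    intro i
    rw [memLp_two_iff_integrable_sq (hgc i).aestronglyMeasurable]
    refine hg2.mono' ((hgc i).pow 2).aestronglyMeasurable (Eventually.of_forall fun x => ?_)
    rw [Real.norm_of_nonneg (sq_nonneg _)]
    exact Finset.single_le_sum (f := fun i => (g x i) ^ 2) (fun _ _ => sq_nonneg _) (Finset.mem_univ i)
  have H1 := fun i => lim_one y θ hσ2 hv (fun x => (y i - g x i) ^ 2) (((continuous_const).sub (hgc i)).pow 2)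
    ((memLp_const (y i)).sub (hmem i)).integrable_sq
  have hD : HasFDerivAt g (fderiv ℝ g y) y := (hg.differentiable one_ne_zero y).hasFDerivAt
  have H2 := fun i => lim_two y θ hσ2 hv (fun x => g x i) (hgc i)
    ((ContinuousLinearMap.proj i).comp (fderiv ℝ g y)) (hasFDerivAt_pi'.mp hD i) (hmem i) i
  have hsq : Tendsto Real.sqrt (nhdsWithin 0 (Set.Ioi 0)) (nhdsWithin 0 (Set.Ioi 0)) := by
    refine tendsto_nhdsWithin_iff.mpr ⟨?_, ?_⟩
    · have := (Real.continuous_sqrt.tendsto 0).mono_left (nhdsWithin_le_nhds (s := Set.Ioi 0))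
      simpa using this
    · filter_upwards [self_mem_nhdsWithin] with a ha using Real.sqrt_pos.mpr ha
  have T : Tendsto (fun a : ℝ => ∑ i, ((∫ w, (y i - g (fun j => y j + a * w j) i) ^ 2 ∂(gaussianPi n 0 σ2))
      + 2 * ∫ w, a⁻¹ * (w i * (g (fun j => y j + a * w j) i - g y i)) ∂(gaussianPi n 0 σ2)))
      (nhdsWithin 0 (Set.Ioi 0))
      (nhds (∑ i, ((y i - g y i) ^ 2 + 2 * (σ2 * fderiv ℝ g y (Pi.single i 1) i)))) :=
    tendsto_finsetSum _ fun i _ => (H1 i).2.add ((H2 i).2.const_mul 2)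
  have hlim : (∑ i, ((y i - g y i) ^ 2 + 2 * (σ2 * fderiv ℝ g y (Pi.single i 1) i)))
      = (∑ i, (y i - g y i) ^ 2) + 2 * σ2 * (∑ i, fderiv ℝ g y (Pi.single i 1) i) := by
    rw [Finset.sum_add_distrib, Finset.mul_sum]
    congr 1
    exact Finset.sum_congr rfl fun i _ => by ring
  rw [hlim] at T
  refine Tendsto.sub_const ?_ _
  refine (T.comp hsq).congr' ?_
  have I1 := hsq.eventually (eventually_all.mpr fun i => (H1 i).1)
  have I2 := hsq.eventually (eventually_all.mpr fun i => (H2 i).1)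
  filter_upwards [I1, I2, self_mem_nhdsWithin] with α h1 h2 hα
  have hα : 0 < α := hα
  have ha : 0 < Real.sqrt α := Real.sqrt_pos.mpr hα
  have haa : α = Real.sqrt α ^ 2 := (Real.sq_sqrt hα.le).symm
  simp only [Function.comp]
  set a := Real.sqrt α with hadef
  have hw : ∀ i, Integrable (fun w : Fin n → ℝ => w i) (gaussianPi n 0 σ2) := fun i =>
    (gp_memLp_s7 0 σ2 i).integrable one_le_two
  have e : ∀ w : Fin n → ℝ, (∑ i, (y i - w i / a - g (fun j => y j + a * w j) i) ^ 2)
            - (∑ i, (w i) ^ 2) / α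
      = ∑ i, ((y i - g (fun j => y j + a * w j) i) ^ 2
        + 2 * (a⁻¹ * (w i * (g (fun j => y j + a * w j) i - g y i)))
        + (-2 * a⁻¹ * (y i - g y i)) * w i) := by
    intro w
    rw [Finset.sum_div, ← Finset.sum_sub_distrib]
    refine Finset.sum_congr rfl fun i _ => ?_
    rw [haa]
    field_simp
    ring
  simp_rw [e]
  have hA : ∀ i, Integrable (fun w : Fin n → ℝ => (y i - g (fun j => y j + a * w j) i) ^ 2
        + 2 * (a⁻¹ * (w i * (g (fun j => y j + a * w j) i - g y i)))) (gaussianPi n 0 σ2) :=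
    fun i => (h1 i).add ((h2 i).const_mul 2)
  have hB : ∀ i, Integrable (fun w : Fin n → ℝ => (y i - g (fun j => y j + a * w j) i) ^ 2
        + 2 * (a⁻¹ * (w i * (g (fun j => y j + a * w j) i - g y i)))
        + (-2 * a⁻¹ * (y i - g y i)) * w i) (gaussianPi n 0 σ2) :=
    fun i => (hA i).add ((hw i).const_mul _)
  rw [integral_finsetSum _ fun i _ => hB i]
  refine Finset.sum_congr rfl fun i _ => ?_
  rw [integral_add (hA i) ((hw i).const_mul _),
    integral_add (h1 i) ((h2 i).const_mul 2), integral_const_mul, integral_const_mul, integral_const_mul,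
    integral_const_mul, gp_mean_s7]
  ring
end

section
/- Let phi : R^n -> R be the standard Gaussian density (mean zero, identity covariance), and for alpha > 0 set phi_alpha(x) = alpha^{-n} phi(x/alpha). Let f : R^n -> R be a measurable function such that the product f * phi_beta (pointwise product of f with the function x |-> beta^{-n} phi(x/beta)) is Lebesgue integrable on R^n for some beta > 0. Then for Lebesgue-almost every x in R^n, the convolution (f star phi_alpha)(x) = integral of f(x - t) phi_alpha(t) dt converges to f(x) as alpha -> 0. -/
open MeasureTheory Filter

/-- The standard Gaussian density on `ℝⁿ` (mean zero, identity covariance). -/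
noncomputable def stdGaussDens (n : ℕ) (x : Fin n → ℝ) : ℝ :=
  (2 * Real.pi) ^ (-(n : ℝ) / 2) * Real.exp (-(∑ i, (x i) ^ 2) / 2)

lemma gaussA (n : ℕ) (b : ℝ) (hb : 0 < b) :
    Integrable (fun t : Fin n → ℝ => Real.exp (-b * ∑ i, (t i)^2)) ∧
    ∫ t : Fin n → ℝ, Real.exp (-b * ∑ i, (t i)^2) = (Real.sqrt (Real.pi / b)) ^ n := by
  have he : (fun t : Fin n → ℝ => Real.exp (-b * ∑ i, (t i)^2))
      = fun t => ∏ i, Real.exp (-b * (t i)^2) := by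
    funext t; rw [Finset.mul_sum, Real.exp_sum]
  rw [he]
  refine ⟨?_, ?_⟩
  · exact Integrable.fintype_prod (f := fun _ : Fin n => fun x : ℝ => Real.exp (-b * x^2))
      (fun _ => integrable_exp_neg_mul_sq hb)
  · rw [integral_fintype_prod_volume_eq_prod (fun _ : Fin n => fun x : ℝ => Real.exp (-b * x^2))]
    simp only [integral_gaussian, Finset.prod_const, Finset.card_univ, Fintype.card_fin]

lemma summA (n : ℕ) : Summable (fun k : ℕ => Real.exp (-(k:ℝ)^2/4) * ((k:ℝ)+1)^n) := by
  have h0 : Summable (fun k : ℕ => ((k:ℝ))^n * Real.exp (-(1/4)*k)) :=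
    Real.summable_pow_mul_exp_neg_nat_mul n (by norm_num)
  have h1 := ((summable_nat_add_iff 1).2 h0).mul_left (Real.exp (1/4))
  refine Summable.of_nonneg_of_le (fun k => by positivity) (fun k => ?_) h1
  push_cast
  have : Real.exp (-(k:ℝ)^2/4) ≤ Real.exp (1/4) * Real.exp (-(1/4)*((k:ℝ)+1)) := by
    rw [← Real.exp_add]
    apply Real.exp_le_exp.2
    have : (k:ℝ) ≤ (k:ℝ)^2 := by
      rcases Nat.eq_zero_or_pos k with h | h
      · simp [h]
      · have : (1:ℝ) ≤ k := by exact_mod_cast h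
        nlinarith
    linarith
  calc _ ≤ (Real.exp (1/4) * Real.exp (-(1/4)*((k:ℝ)+1))) * ((k:ℝ)+1)^n := by gcongr
    _ = _ := by ring

lemma stepB {E : Type*} [PseudoMetricSpace E] [MeasurableSpace E] [BorelSpace E] (μ : Measure E)
    (w : E → ℝ) (hw0 : ∀ y, 0 ≤ w y) (hw : Integrable w μ) (x : E) (α : ℝ) (hα : 0 < α)
    (hs : Summable (fun k : ℕ => Real.exp (-(k:ℝ)^2/4) * ∫ y in Metric.closedBall x ((k+1)*α), w y ∂μ)) :
    ∫ y, w y * Real.exp (-(dist y x)^2/(4*α^2)) ∂μ ≤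
      ∑' k : ℕ, Real.exp (-(k:ℝ)^2/4) * ∫ y in Metric.closedBall x ((k+1)*α), w y ∂μ := by
  have hnn : ∀ k : ℕ, 0 ≤ Real.exp (-(k:ℝ)^2/4) * ∫ y in Metric.closedBall x ((k+1)*α), w y ∂μ :=
    fun k => mul_nonneg (Real.exp_pos _).le (integral_nonneg hw0)
  rw [integral_eq_lintegral_of_nonneg_ae (ae_of_all _ fun y => mul_nonneg (hw0 y) (Real.exp_pos _).le)
    (hw.1.mul (by fun_prop : Continuous fun y : E => Real.exp (-(dist y x)^2/(4*α^2))).aestronglyMeasurable)]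
  apply ENNReal.toReal_le_of_le_ofReal (tsum_nonneg hnn)
  rw [ENNReal.ofReal_tsum_of_nonneg hnn hs]
  have hk : ∀ k : ℕ, ENNReal.ofReal (Real.exp (-(k:ℝ)^2/4) * ∫ y in Metric.closedBall x ((k+1)*α), w y ∂μ)
      = ∫⁻ y, (Metric.closedBall x ((k+1)*α)).indicator
          (fun y => ENNReal.ofReal (Real.exp (-(k:ℝ)^2/4) * w y)) y ∂μ := by
    intro k
    rw [lintegral_indicator Metric.isClosed_closedBall.measurableSet, ← integral_const_mul,
      ofReal_integral_eq_lintegral_ofReal (hw.integrableOn.const_mul _)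
        (ae_of_all _ fun y => mul_nonneg (Real.exp_pos _).le (hw0 y))]
  simp_rw [hk]
  rw [← lintegral_tsum]
  · apply lintegral_mono
    intro y
    refine le_trans ?_ (ENNReal.le_tsum ⌊dist y x / α⌋₊)
    have h1 : dist y x / α < (⌊dist y x / α⌋₊:ℝ) + 1 := Nat.lt_floor_add_one _
    have h2 : (⌊dist y x / α⌋₊:ℝ) ≤ dist y x / α := Nat.floor_le (by positivity)
    rw [Set.indicator_of_mem]
    · apply ENNReal.ofReal_le_ofReal
      rw [mul_comm]
      apply mul_le_mul_of_nonneg_right _ (hw0 y)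
      apply Real.exp_le_exp.2
      have : -(dist y x)^2/(4*α^2) = -(dist y x/α)^2/4 := by field_simp
      rw [this]
      have : (⌊dist y x / α⌋₊:ℝ)^2 ≤ (dist y x / α)^2 := by gcongr
      linarith
    · rw [Metric.mem_closedBall]
      exact ((div_lt_iff₀ hα).1 h1).le
  · intro k
    exact ((hw.1.aemeasurable.const_mul _).ennreal_ofReal).indicator Metric.isClosed_closedBall.measurableSet

lemma keyB {E : Type*} [PseudoMetricSpace E] [MeasurableSpace E] [BorelSpace E] (μ : Measure E)
    (n : ℕ) (w : E → ℝ) (hw0 : ∀ y, 0 ≤ w y) (hw : Integrable w μ) (x : E) 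
    (hq : Tendsto (fun r : ℝ => (∫ y in Metric.closedBall x r, w y ∂μ) / r^n)
      (nhdsWithin 0 (Set.Ioi 0)) (nhds 0)) :
    Tendsto (fun α : ℝ => (α^n)⁻¹ * ∫ y, w y * Real.exp (-(dist y x)^2/(4*α^2)) ∂μ)
      (nhdsWithin 0 (Set.Ioi 0)) (nhds 0) := by
  set H : ℝ → ℝ := fun r => ∫ y in Metric.closedBall x r, w y ∂μ with hH
  have H0 : ∀ r, 0 ≤ H r := fun r => integral_nonneg hw0
  have HM : ∀ r, H r ≤ ∫ y, w y ∂μ := fun r => setIntegral_le_integral hw (ae_of_all _ hw0)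
  obtain ⟨A, hA⟩ : ∃ A, ∀ r, 0 < r → H r / r^n ≤ A := by
    have h1 : ∀ᶠ r in nhdsWithin (0:ℝ) (Set.Ioi 0), H r / r^n < 1 :=
      hq.eventually (gt_mem_nhds one_pos)
    obtain ⟨δ, hδ, hd⟩ := (mem_nhdsGT_iff_exists_Ioo_subset).1 h1
    have hδ : 0 < δ := hδ
    refine ⟨max 1 ((∫ y, w y ∂μ) / δ^n), fun r hr => ?_⟩
    rcases lt_or_ge r δ with h | h
    · exact le_max_of_le_left (le_of_lt (hd ⟨hr, h⟩))
    · apply le_max_of_le_right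
      have : 0 ≤ ∫ y, w y ∂μ := integral_nonneg hw0
      have := HM r
      gcongr
  have hterm : ∀ α : ℝ, 0 < α → ∀ k : ℕ, (α^n)⁻¹ * (Real.exp (-(k:ℝ)^2/4) * H ((k+1)*α))
      = Real.exp (-(k:ℝ)^2/4) * ((k:ℝ)+1)^n * (H ((k+1)*α) / ((k+1)*α)^n) := by
    intro α hα k
    have : (k:ℝ)+1 ≠ 0 := by positivity
    rw [mul_pow]
    field_simp
  have hsum := (summA n).mul_right A
  have hbd : ∀ α : ℝ, 0 < α → ∀ k : ℕ,
      ‖Real.exp (-(k:ℝ)^2/4) * ((k:ℝ)+1)^n * (H ((k+1)*α) / ((k+1)*α)^n)‖ ≤ 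
      Real.exp (-(k:ℝ)^2/4) * ((k:ℝ)+1)^n * A := by
    intro α hα k
    have h3 := H0 ((k+1)*α)
    rw [Real.norm_of_nonneg (by positivity)]
    have := hA ((k+1)*α) (by positivity)
    gcongr
  have hT : Tendsto (fun α : ℝ => ∑' k : ℕ, Real.exp (-(k:ℝ)^2/4) * ((k:ℝ)+1)^n * (H ((k+1)*α) / ((k+1)*α)^n))
      (nhdsWithin 0 (Set.Ioi 0)) (nhds (∑' k : ℕ, (0:ℝ))) := by
    refine tendsto_tsum_of_dominated_convergence hsum ?_ ?_
    · intro k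
      have : Tendsto (fun α : ℝ => ((k:ℝ)+1)*α) (nhdsWithin 0 (Set.Ioi 0)) (nhdsWithin 0 (Set.Ioi 0)) := by
        refine tendsto_nhdsWithin_iff.2 ⟨?_, ?_⟩
        · have : Tendsto (fun α : ℝ => ((k:ℝ)+1)*α) (nhds 0) (nhds (((k:ℝ)+1)*0)) :=
            (continuous_const.mul continuous_id).tendsto 0
          rw [mul_zero] at this
          exact this.mono_left nhdsWithin_le_nhds
        · filter_upwards [self_mem_nhdsWithin] with α hα
          have : 0 < α := hα
          exact Set.mem_Ioi.2 (by positivity)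
      have := (hq.comp this).const_mul (Real.exp (-(k:ℝ)^2/4) * ((k:ℝ)+1)^n)
      rw [mul_zero] at this
      exact this
    · filter_upwards [self_mem_nhdsWithin] with α hα using hbd α hα
  rw [tsum_zero] at hT
  refine squeeze_zero' ?_ ?_ hT
  · filter_upwards [self_mem_nhdsWithin] with α hα
    have : 0 < α := hα
    exact mul_nonneg (by positivity) (integral_nonneg fun y => mul_nonneg (hw0 y) (Real.exp_pos _).le)
  · filter_upwards [self_mem_nhdsWithin] with α hα
    have hα : 0 < α := hα
    have hs2 : Summable fun k : ℕ => (α^n)⁻¹ * (Real.exp (-(k:ℝ)^2/4) * H ((k+1)*α)) := by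
      simp_rw [hterm α hα]
      exact Summable.of_norm_bounded hsum (hbd α hα)
    have hs : Summable fun k : ℕ => (Real.exp (-(k:ℝ)^2/4) * H ((k+1)*α)) := 
      (summable_mul_left_iff (by positivity)).1 hs2
    rw [← tsum_congr (hterm α hα), tsum_mul_left]
    exact mul_le_mul_of_nonneg_left (stepB μ w hw0 hw x α hα hs) (by positivity)

lemma stdG_eq (n : ℕ) (a : ℝ) (t : Fin n → ℝ) :
    (a ^ n)⁻¹ * stdGaussDens n (fun i => t i / a) =
      (2 * Real.pi) ^ (-(n : ℝ) / 2) * (a ^ n)⁻¹ * Real.exp (-(1/(2*a^2)) * ∑ i, (t i)^2) := by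
  unfold stdGaussDens
  have : -(∑ i, (t i / a)^2) / 2 = -(1/(2*a^2)) * ∑ i, (t i)^2 := by
    simp_rw [div_pow]
    rw [← Finset.sum_div]
    simp only [one_div, mul_inv]
    ring
  rw [this]
  ring

lemma stdG_norm (n : ℕ) (a : ℝ) (ha : 0 < a) :
    (2 * Real.pi) ^ (-(n : ℝ) / 2) * (a ^ n)⁻¹ * (Real.sqrt (Real.pi / (1/(2*a^2)))) ^ n = 1 := by
  have hp := Real.pi_pos
  have h1 : Real.sqrt (Real.pi / (1/(2*a^2))) = Real.sqrt (2 * Real.pi) * a := by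
    rw [show Real.pi / (1/(2*a^2)) = (2 * Real.pi) * a^2 by field_simp]
    rw [Real.sqrt_mul (by positivity), Real.sqrt_sq ha.le]
  have h2 : (2 * Real.pi) ^ (-(n : ℝ) / 2) = ((Real.sqrt (2 * Real.pi))^n)⁻¹ := by
    rw [Real.sqrt_eq_rpow, ← Real.rpow_natCast, ← Real.rpow_mul (by positivity),
      ← Real.rpow_neg (by positivity)]
    congr 1
    ring
  have h3 : 0 < Real.sqrt (2 * Real.pi) := by positivity
  rw [h1, h2, mul_pow]
  field_simp

/-- **Almost-everywhere convergence of Gaussian mollification (Lemma C.2).**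
Let `φ` be the standard Gaussian density on `ℝⁿ` and `φ_α(x) = α⁻ⁿ φ(x/α)`.  If
`f : ℝⁿ → ℝ` is measurable and `f · φ_β` is Lebesgue integrable for some `β > 0`, then for
Lebesgue-almost every `x`, `(f ⋆ φ_α)(x) → f(x)` as `α → 0⁺`. -/
theorem gaussian_mollification_ae_tendsto
    (n : ℕ) (f : (Fin n → ℝ) → ℝ) (hf : Measurable f)
    (β : ℝ) (hβ : 0 < β)
    (hint : Integrable
      (fun x => f x * ((β ^ n)⁻¹ * stdGaussDens n (fun i => x i / β)))
      (volume : Measure (Fin n → ℝ))) :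
    ∀ᵐ x ∂(volume : Measure (Fin n → ℝ)),
      Tendsto (fun α : ℝ =>
          ∫ t, f (x - t) * ((α ^ n)⁻¹ * stdGaussDens n (fun i => t i / α))
            ∂(volume : Measure (Fin n → ℝ)))
        (nhdsWithin 0 (Set.Ioi 0)) (nhds (f x)) := by
  set c : ℝ := (2 * Real.pi) ^ (-(n : ℝ) / 2) with hc
  have hc0 : 0 < c := by positivity
  simp_rw [stdG_eq n] at hint ⊢
  rw [← hc] at hint ⊢
  set S : (Fin n → ℝ) → ℝ := fun t => ∑ i, (t i)^2 with hS
  have hSc : Continuous S := by fun_prop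
  have hloc : LocallyIntegrable f volume := by
    have h1 := hint.locallyIntegrable.mul_continuous
      (g := fun x => (c * (β ^ n)⁻¹ * Real.exp (-(1/(2*β^2)) * S x))⁻¹)
      (Continuous.inv₀ (by fun_prop) (fun x => by positivity))
    refine h1.congr (ae_of_all _ fun x => ?_)
    have : c * (β ^ n)⁻¹ * Real.exp (-(1/(2*β^2)) * S x) ≠ 0 := by positivity
    exact mul_inv_cancel_right₀ this _
  have hdist : ∀ x y : Fin n → ℝ, (dist y x)^2 ≤ S (x - y) := by
    intro x y
    have h0 : 0 ≤ S (x - y) := Finset.sum_nonneg fun i _ => sq_nonneg _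
    have : dist y x ≤ Real.sqrt (S (x - y)) := by
      refine (dist_pi_le_iff (Real.sqrt_nonneg _)).2 fun i => ?_
      apply Real.le_sqrt_of_sq_le
      rw [Real.dist_eq, sq_abs]
      have := Finset.single_le_sum (f := fun i => ((x - y) i)^2) (fun i _ => sq_nonneg _) (Finset.mem_univ i)
      refine le_trans (le_of_eq ?_) this
      simp only [Pi.sub_apply]
      ring
    calc (dist y x)^2 ≤ (Real.sqrt (S (x-y)))^2 := by gcongr
      _ = _ := Real.sq_sqrt h0
  have hS0 : ∀ t, 0 ≤ S t := fun t => Finset.sum_nonneg fun i _ => sq_nonneg _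
  have hS2 : ∀ x y : Fin n → ℝ, S y ≤ 2 * S x + 2 * S (x - y) := by
    intro x y
    simp only [hS, Finset.mul_sum, ← Finset.sum_add_distrib]
    apply Finset.sum_le_sum
    intro i _
    simp only [Pi.sub_apply]
    nlinarith [sq_nonneg (2 * x i - y i)]
  have hfe : ∀ x, ∀ b : ℝ, 1/β^2 ≤ b → Integrable (fun y => f y * Real.exp (-b * S (x - y))) := by
    intro x b hb
    refine ((hint.norm.const_mul (β^n * c⁻¹ * Real.exp (1/β^2 * S x)))).mono'
      (hf.aestronglyMeasurable.mul (by fun_prop : Continuous fun y => Real.exp (-b * S (x - y))).aestronglyMeasurable)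
      (ae_of_all _ fun y => ?_)
    rw [norm_mul, norm_mul, Real.norm_of_nonneg (Real.exp_pos _).le,
      Real.norm_of_nonneg (by positivity : 0 ≤ c * (β ^ n)⁻¹ * Real.exp (-(1/(2*β^2)) * S y))]
    have : Real.exp (-b * S (x - y)) ≤ Real.exp (1/β^2 * S x) * Real.exp (-(1/(2*β^2)) * S y) := by
      rw [← Real.exp_add]
      apply Real.exp_le_exp.2
      have h1 : b * S (x-y) ≥ 1/β^2 * S (x - y) := mul_le_mul_of_nonneg_right hb (hS0 _)
      have h2 : 1/(2*β^2) * S y ≤ 1/(2*β^2) * (2 * S x + 2 * S (x - y)) :=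
        mul_le_mul_of_nonneg_left (hS2 x y) (by positivity)
      have h3 : 1/(2*β^2) * (2 * S x + 2 * S (x - y)) = 1/β^2 * S x + 1/β^2 * S (x-y) := by
        field_simp
      linarith
    calc ‖f y‖ * Real.exp (-b * S (x - y)) ≤ ‖f y‖ * (Real.exp (1/β^2 * S x) * Real.exp (-(1/(2*β^2)) * S y)) := by
          gcongr
      _ = _ := by field_simp
  have hge : ∀ x, ∀ b : ℝ, 0 < b → Integrable (fun y => Real.exp (-b * S (x - y))) := fun x b hb =>
    (gaussA n b hb).1.comp_sub_left x
  filter_upwards [(Besicovitch.vitaliFamily (volume : Measure (Fin n → ℝ))).ae_tendsto_average_norm_sub hloc]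
    with x hx
  have hx := hx.comp (Besicovitch.tendsto_filterAt volume x)
  set w : (Fin n → ℝ) → ℝ := fun y => ‖f y - f x‖ * Real.exp (-(1/β^2) * S (x - y)) with hwdef
  have hw0 : ∀ y, 0 ≤ w y := fun y => by positivity
  have hw : Integrable w := by
    have := ((hfe x _ le_rfl).sub ((hge x (1/β^2) (by positivity)).const_mul (f x))).norm
    refine this.congr (ae_of_all _ fun y => ?_)
    simp only [Pi.sub_apply, hwdef]
    rw [← sub_mul, norm_mul, Real.norm_of_nonneg (Real.exp_pos _).le]
  have hq : Tendsto (fun r : ℝ => (∫ y in Metric.closedBall x r, w y) / r^n)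
      (nhdsWithin 0 (Set.Ioi 0)) (nhds 0) := by
    have h2 := hx.const_mul (2^n : ℝ)
    rw [mul_zero] at h2
    refine squeeze_zero' ?_ ?_ h2
    · filter_upwards [self_mem_nhdsWithin] with r hr
      have : 0 < r := hr
      exact div_nonneg (integral_nonneg hw0) (by positivity)
    · filter_upwards [self_mem_nhdsWithin] with r hr
      have hr : 0 < r := hr
      have hv : (volume : Measure (Fin n → ℝ)).real (Metric.closedBall x r) = (2*r)^n := by
        rw [measureReal_def, Real.volume_pi_closedBall x hr.le, Fintype.card_fin,
          ENNReal.toReal_ofReal (by positivity)]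
      simp only [Function.comp_apply]
      rw [setAverage_eq, hv, smul_eq_mul]
      have hle : ∫ y in Metric.closedBall x r, w y ≤ ∫ y in Metric.closedBall x r, ‖f y - f x‖ := by
        apply integral_mono_of_nonneg (ae_of_all _ hw0)
        · have hfi : IntegrableOn f (Metric.closedBall x r) :=
            hloc.integrableOn_isCompact (isCompact_closedBall x r)
          exact (hfi.sub (integrableOn_const (by exact (isCompact_closedBall x r).measure_lt_top.ne))).norm
        · refine ae_of_all _ fun y => ?_
          apply mul_le_of_le_one_right (norm_nonneg _)
          apply Real.exp_le_one_iff.2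
          have := mul_nonneg (by positivity : 0 ≤ 1/β^2) (hS0 (x - y))
          linarith
      rw [mul_pow]
      calc _ ≤ (∫ y in Metric.closedBall x r, ‖f y - f x‖) / r^n := by gcongr
        _ = _ := by field_simp
  have hkey := (keyB volume n w hw0 hw x hq).const_mul c
  rw [mul_zero] at hkey
  rw [tendsto_iff_norm_sub_tendsto_zero]
  refine squeeze_zero' (Eventually.of_forall fun _ => norm_nonneg _) ?_ hkey
  have hβ2 : (0:ℝ) < β/2 := by positivity
  filter_upwards [Ioo_mem_nhdsGT hβ2] with α hα
  have hα0 : 0 < α := hα.1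
  have hb4 : 1/β^2 ≤ 1/(4*α^2) := by
    apply one_div_le_one_div_of_le (by positivity)
    nlinarith [hα.2]
  have hb2 : 1/(2*α^2) = 1/(4*α^2) + 1/(4*α^2) := by field_simp; norm_num
  have hb4' : 0 < 1/(4*α^2) := by positivity
  have hchg : ∫ t, f (x - t) * (c * (α ^ n)⁻¹ * Real.exp (-(1/(2*α^2)) * S t))
      = ∫ y, f y * (c * (α ^ n)⁻¹ * Real.exp (-(1/(2*α^2)) * S (x - y))) := by
    rw [← integral_sub_left_eq_self (fun y => f y * (c * (α ^ n)⁻¹ * Real.exp (-(1/(2*α^2)) * S (x - y)))) volume x]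
    simp only [sub_sub_cancel]
  have hone : ∫ y, c * (α ^ n)⁻¹ * Real.exp (-(1/(2*α^2)) * S (x - y)) = 1 := by
    rw [integral_sub_left_eq_self (fun y => c * (α ^ n)⁻¹ * Real.exp (-(1/(2*α^2)) * S y)) volume x,
      integral_const_mul, (gaussA n (1/(2*α^2)) (by positivity)).2]
    exact stdG_norm n α hα0
  have hI1 : Integrable fun y => f y * (c * (α ^ n)⁻¹ * Real.exp (-(1/(2*α^2)) * S (x - y))) := by
    refine ((hfe x (1/(2*α^2)) (by linarith)).const_mul (c * (α ^ n)⁻¹)).congr (ae_of_all _ fun y => ?_)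
    ring
  have hI2 : Integrable fun y => f x * (c * (α ^ n)⁻¹ * Real.exp (-(1/(2*α^2)) * S (x - y))) :=
    ((hge x (1/(2*α^2)) (by positivity)).const_mul (c * (α ^ n)⁻¹)).const_mul (f x)
  have hfx : f x = ∫ y, f x * (c * (α ^ n)⁻¹ * Real.exp (-(1/(2*α^2)) * S (x - y))) := by
    rw [integral_const_mul, hone, mul_one]
  rw [hchg]
  conv_lhs => rw [hfx]
  rw [← integral_sub hI1 hI2]
  refine (norm_integral_le_integral_norm _).trans ?_
  rw [← integral_const_mul, ← integral_const_mul]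
  apply integral_mono_of_nonneg (ae_of_all _ fun y => norm_nonneg _)
  · refine Integrable.const_mul (Integrable.const_mul ?_ _) _
    refine hw.mono (hw.1.mul (by fun_prop : Continuous fun y : Fin n → ℝ => Real.exp (-(dist y x)^2/(4*α^2))).aestronglyMeasurable)
      (ae_of_all _ fun y => ?_)
    rw [norm_mul]
    apply mul_le_of_le_one_right (norm_nonneg _)
    rw [Real.norm_of_nonneg (Real.exp_pos _).le]
    apply Real.exp_le_one_iff.2
    rw [neg_div]
    exact neg_nonpos.2 (by positivity)
  · refine ae_of_all _ fun y => ?_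
    have he : Real.exp (-(1/(2*α^2)) * S (x - y)) ≤
        Real.exp (-(1/β^2) * S (x - y)) * Real.exp (-(dist y x)^2/(4*α^2)) := by
      rw [← Real.exp_add]
      apply Real.exp_le_exp.2
      have h1 := mul_le_mul_of_nonneg_right hb4 (hS0 (x - y))
      have h2 := mul_le_mul_of_nonneg_left (hdist x y) hb4'.le
      have h3 : -(dist y x)^2/(4*α^2) = -(1/(4*α^2) * (dist y x)^2) := by ring
      rw [h3, hb2]
      linarith
    simp only
    rw [← sub_mul, norm_mul, Real.norm_of_nonneg (by positivity : 0 ≤ c * (α ^ n)⁻¹ * Real.exp (-(1/(2*α^2)) * S (x - y)))]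
    calc _ ≤ ‖f y - f x‖ * (c * (α ^ n)⁻¹ * (Real.exp (-(1/β^2) * S (x - y)) * Real.exp (-(dist y x)^2/(4*α^2)))) := by
          gcongr
      _ = _ := by simp only [hwdef]; ring
end

section
/- Let Y be a random vector in R^n with E[Y] = theta and Cov(Y) = sigma^2 I_n, and let g : R^n -> R^n be measurable with E||g(Y)||_2^2 < infinity. Then E||theta - g(Y)||_2^2 = E||Y - g(Y)||_2^2 + 2 * sum_{i=1}^n Cov(Y_i, g_i(Y)) - n sigma^2. -/
open MeasureTheory ProbabilityTheory

/-- **Efron's covariance decomposition (optimism theorem).**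
Let `Y` be a random vector in `ℝⁿ` with `E[Y] = θ` and `Cov(Y) = σ² Iₙ` (no normality
assumed), and let `g : ℝⁿ → ℝⁿ` be measurable with `E‖g(Y)‖² < ∞`.  Then
`E‖θ - g(Y)‖² = E‖Y - g(Y)‖² + 2 ∑ᵢ Cov(Yᵢ, gᵢ(Y)) - n σ²`. -/
theorem efron_covariance_decomposition
    {Ω : Type*} [MeasurableSpace Ω] {μ : Measure Ω} [IsProbabilityMeasure μ]
    {n : ℕ} (Y : Ω → (Fin n → ℝ)) (hY : Measurable Y)
    (θ : Fin n → ℝ) (σ2 : ℝ)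
    (hY2 : ∀ i, MemLp (fun ω => Y ω i) 2 μ)
    (hmean : ∀ i, (∫ ω, Y ω i ∂μ) = θ i)
    (hcov : ∀ i j, (∫ ω, (Y ω i - θ i) * (Y ω j - θ j) ∂μ) = if i = j then σ2 else 0)
    (g : (Fin n → ℝ) → (Fin n → ℝ)) (hg : Measurable g)
    (hg2 : Integrable (fun ω => ∑ i, (g (Y ω) i) ^ 2) μ) :
    (∫ ω, ∑ i, (θ i - g (Y ω) i) ^ 2 ∂μ)
      = (∫ ω, ∑ i, (Y ω i - g (Y ω) i) ^ 2 ∂μ)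
        + 2 * (∑ i, ∫ ω, (Y ω i - ∫ ω', Y ω' i ∂μ)
            * (g (Y ω) i - ∫ ω', g (Y ω') i ∂μ) ∂μ)
        - n * σ2 := by
  have hgm : ∀ i, Measurable (fun ω => g (Y ω) i) := fun i =>
    (measurable_pi_apply i).comp (hg.comp hY)
  have hgL : ∀ i, MemLp (fun ω => g (Y ω) i) 2 μ := by
    intro i
    rw [memLp_two_iff_integrable_sq (hgm i).aestronglyMeasurable]
    refine hg2.mono' ((hgm i).pow_const 2).aestronglyMeasurable (ae_of_all _ fun ω => ?_)
    rw [Real.norm_of_nonneg (sq_nonneg _)]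
    exact Finset.single_le_sum (f := fun i => (g (Y ω) i) ^ 2)
      (fun j _ => sq_nonneg _) (Finset.mem_univ i)
  have hc : ∀ c : ℝ, MemLp (fun _ : Ω => c) 2 μ := fun c => memLp_const c
  have h1 : ∀ i, Integrable (fun ω => (θ i - g (Y ω) i) ^ 2) μ := fun i =>
    ((hc (θ i)).sub (hgL i)).integrable_sq
  have h2 : ∀ i, Integrable (fun ω => (Y ω i - g (Y ω) i) ^ 2) μ := fun i =>
    ((hY2 i).sub (hgL i)).integrable_sq
  have hD : ∀ i, MemLp (fun ω => Y ω i - θ i) 2 μ := fun i => (hY2 i).sub (hc (θ i))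
  have key : ∀ i, (∫ ω, (θ i - g (Y ω) i) ^ 2 ∂μ) = (∫ ω, (Y ω i - g (Y ω) i) ^ 2 ∂μ)
      + 2 * (∫ ω, (Y ω i - θ i) * (g (Y ω) i - ∫ ω', g (Y ω') i ∂μ) ∂μ) - σ2 := by
    intro i
    set m := ∫ ω', g (Y ω') i ∂μ
    have h3 : Integrable (fun ω => (Y ω i - θ i) * (g (Y ω) i - m)) μ :=
      (hD i).integrable_mul ((hgL i).sub (hc m))
    have h4 : Integrable (fun ω => (Y ω i - θ i) * (Y ω i - θ i)) μ :=
      (hD i).integrable_mul (hD i)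
    have h5 : Integrable (fun ω => Y ω i - θ i) μ := (hD i).integrable (by norm_num)
    have h6 : ∫ ω, (Y ω i - θ i) ∂μ = 0 := by
      rw [integral_sub ((hY2 i).integrable (by norm_num)) (integrable_const _), hmean i]
      simp
    have h7 := hcov i i
    rw [if_pos rfl] at h7
    have e : ∀ ω, (θ i - g (Y ω) i) ^ 2 = (Y ω i - g (Y ω) i) ^ 2
        + 2 * ((Y ω i - θ i) * (g (Y ω) i - m)) - (Y ω i - θ i) * (Y ω i - θ i)
        + 2 * (m - θ i) * (Y ω i - θ i) := fun ω => by ring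
    simp_rw [e]
    have h8 : Integrable (fun ω => (Y ω i - g (Y ω) i) ^ 2
        + 2 * ((Y ω i - θ i) * (g (Y ω) i - m))) μ := (h2 i).add (h3.const_mul 2)
    have h9 : Integrable (fun ω => (Y ω i - g (Y ω) i) ^ 2
        + 2 * ((Y ω i - θ i) * (g (Y ω) i - m)) - (Y ω i - θ i) * (Y ω i - θ i)) μ := h8.sub h4
    rw [integral_add h9 (h5.const_mul _), integral_sub h8 h4,
      integral_add (h2 i) (h3.const_mul 2), integral_const_mul, integral_const_mul, h6, h7]
    ring
  rw [integral_finsetSum _ (fun i _ => h1 i), integral_finsetSum _ (fun i _ => h2 i)]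
  simp_rw [hmean, key]
  rw [Finset.sum_sub_distrib, Finset.sum_add_distrib, Finset.mul_sum]
  simp
end

section
/- For alpha >= 0 let Y_alpha ~ N(theta, (1+alpha) sigma^2 I_n), Risk_alpha(g) = E||theta - g(Y_alpha)||_2^2, and Risk(g) = Risk_0(g), where theta is in R^n, sigma^2 > 0, and g : R^n -> R^n is measurable. Assume E[ ||g(Y_beta)||_2^2 * ||Y_beta - theta||_2^{2m} ] < infinity and E[ ||g(Y_beta)||_2^4 * ||Y_beta - theta||_2^{2m} ] < infinity for m = 0, 1 and some beta > 0. Then there exist a constant C > 0 and alpha_0 in (0, beta) such that for all alpha in [0, alpha_0): |Risk_alpha(g) - Risk(g)| <= (sqrt(n) * alpha / sqrt(2)) * sqrt( Var(||theta - g(Y)||_2^2) ) + C * alpha^{3/2}, where Y = Y_0 ~ N(theta, sigma^2 I_n). -/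
open MeasureTheory ProbabilityTheory

/-- The covariance of two real-valued functions under a measure `ν`. -/
noncomputable def covar {X : Type*} [MeasurableSpace X] (ν : Measure X) (f h : X → ℝ) : ℝ :=
  ∫ x, (f x - ∫ y, f y ∂ν) * (h x - ∫ y, h y ∂ν) ∂ν

/-- The variance of a real-valued function under a measure `ν`. -/
noncomputable def varUnder {X : Type*} [MeasurableSpace X] (ν : Measure X) (f : X → ℝ) : ℝ :=
  covar ν f f


theorem cs_int {X : Type*} [MeasurableSpace X] (μ : Measure X) (a b : X → ℝ)
    (ha : MemLp a 2 μ) (hb : MemLp b 2 μ) :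
    |∫ x, a x * b x ∂μ| ≤ Real.sqrt (∫ x, a x * a x ∂μ) * Real.sqrt (∫ x, b x * b x ∂μ) := by
  have haa : Integrable (fun x => a x * a x) μ := ha.integrable_mul ha
  have hbb : Integrable (fun x => b x * b x) μ := hb.integrable_mul hb
  have hab : Integrable (fun x => a x * b x) μ := ha.integrable_mul hb
  have key : ∀ t : ℝ, 0 ≤ (∫ x, b x * b x ∂μ) * (t * t) + (2 * ∫ x, a x * b x ∂μ) * t
      + ∫ x, a x * a x ∂μ := by
    intro t
    have h1 : (∫ x, b x * b x ∂μ) * (t * t) + (2 * ∫ x, a x * b x ∂μ) * t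
      + ∫ x, a x * a x ∂μ = ∫ x, ((t * t) * (b x * b x) + (2 * t) * (a x * b x)) + a x * a x ∂μ := by
      rw [integral_add _ haa, integral_add (hbb.const_mul _) (hab.const_mul _),
        integral_const_mul, integral_const_mul]
      · ring
      · exact (hbb.const_mul _).add (hab.const_mul _)
    rw [h1]
    apply integral_nonneg
    intro x
    have := sq_nonneg (t * b x + a x)
    simp only [Pi.zero_apply]
    nlinarith
  have hd := discrim_le_zero key
  unfold discrim at hd
  rw [← Real.sqrt_mul (integral_nonneg fun x => mul_self_nonneg _)]
  apply Real.abs_le_sqrt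
  nlinarith

theorem pi_wd {n : ℕ} (μ : Fin n → Measure ℝ) [∀ i, IsProbabilityMeasure (μ i)]
    (ℓ : Fin n → ℝ → ℝ) (h0 : ∀ i x, 0 ≤ ℓ i x)
    (hi : ∀ i, Integrable (ℓ i) (μ i)) :
    Measure.pi (fun i => (μ i).withDensity (fun x => ENNReal.ofReal (ℓ i x)))
      = (Measure.pi μ).withDensity (fun x => ENNReal.ofReal (∏ i, ℓ i (x i))) := by
  have hfin : ∀ i, IsFiniteMeasure ((μ i).withDensity (fun x => ENNReal.ofReal (ℓ i x))) :=
    fun i => isFiniteMeasure_withDensity_ofReal (hi i).2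
  refine Measure.pi_eq fun s hs => ?_
  rw [withDensity_apply _ (MeasurableSet.univ_pi hs), Measure.restrict_pi_pi,
    ← ofReal_integral_eq_lintegral_ofReal, integral_fintype_prod_eq_prod,
    ENNReal.ofReal_prod_of_nonneg]
  · refine Finset.prod_congr rfl fun i _ => ?_
    rw [withDensity_apply _ (hs i), ← ofReal_integral_eq_lintegral_ofReal (hi i).restrict
      (Filter.Eventually.of_forall (h0 i))]
  · exact fun i _ => integral_nonneg (h0 i)
  · exact Integrable.fintype_prod (fun i => (hi i).restrict)
  · exact Filter.Eventually.of_forall fun x => Finset.prod_nonneg fun i _ => h0 i _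

/-- density ratio -/
noncomputable def rat (m v w x : ℝ) : ℝ :=
  gaussianPDFReal m w.toNNReal x / gaussianPDFReal m v.toNNReal x

theorem rat_meas (m v w : ℝ) : Measurable (rat m v w) :=
  (measurable_gaussianPDFReal _ _).div (measurable_gaussianPDFReal _ _)

theorem rat_nonneg (m v w x : ℝ) : 0 ≤ rat m v w x :=
  div_nonneg (gaussianPDFReal_nonneg _ _ _) (gaussianPDFReal_nonneg _ _ _)

theorem rat_wd (m v w : ℝ) (hv : 0 < v) (hw : 0 < w) :
    gaussianReal m w.toNNReal
      = (gaussianReal m v.toNNReal).withDensity (fun x => ENNReal.ofReal (rat m v w x)) := by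
  rw [gaussianReal_of_var_ne_zero m (v := w.toNNReal) (by simpa using hw), 
    gaussianReal_of_var_ne_zero m (v := v.toNNReal) (by simpa using hv),
    ← withDensity_mul _ (measurable_gaussianPDF _ _) (rat_meas m v w).ennreal_ofReal]
  congr 1
  ext x
  have := gaussianPDFReal_pos m v.toNNReal x (by simpa using hv)
  simp only [Pi.mul_apply, gaussianPDF]
  rw [← ENNReal.ofReal_mul this.le, rat]
  congr 1
  field_simp

theorem rat_int (m v w : ℝ) (hv : 0 < v) (hw : 0 < w) :
    Integrable (rat m v w) (gaussianReal m v.toNNReal) := by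
  refine ⟨(rat_meas m v w).aestronglyMeasurable, ?_⟩
  rw [hasFiniteIntegral_iff_ofReal (Filter.Eventually.of_forall (rat_nonneg m v w)),
    ← setLIntegral_univ, ← withDensity_apply _ MeasurableSet.univ, ← rat_wd m v w hv hw]
  exact measure_lt_top _ _

theorem gpi_wd {n : ℕ} (θ : Fin n → ℝ) (v w : ℝ) (hv : 0 < v) (hw : 0 < w) :
    gaussianPi n θ w
      = (gaussianPi n θ v).withDensity (fun x => ENNReal.ofReal (∏ i, rat (θ i) v w (x i))) := by
  unfold gaussianPi
  rw [← pi_wd _ (fun i => rat (θ i) v w) (fun i => rat_nonneg _ _ _)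
    (fun i => rat_int _ _ _ hv hw)]
  congr 1
  ext1 i
  exact rat_wd _ _ _ hv hw

theorem rat_le (m v w : ℝ) (hv : 0 < v) (hvw : v ≤ w) (x : ℝ) :
    rat m w v x ≤ Real.sqrt (w / v) := by
  have hw : 0 < w := hv.trans_le hvw
  have := gaussianPDFReal_pos m w.toNNReal x (by simpa using hw)
  rw [rat, div_le_iff₀ this]
  simp only [gaussianPDFReal, Real.coe_toNNReal _ hv.le, Real.coe_toNNReal _ hw.le]
  rw [← mul_assoc]
  have h1 : (Real.sqrt (2 * Real.pi * v))⁻¹ = Real.sqrt (w / v) * (Real.sqrt (2 * Real.pi * w))⁻¹ := by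
    rw [← Real.sqrt_inv, ← Real.sqrt_inv, ← Real.sqrt_mul (by positivity)]
    congr 1
    field_simp
  rw [h1]
  gcongr ?_ * ?_
  apply Real.exp_le_exp.2
  rw [neg_div, neg_div, neg_le_neg_iff]
  gcongr

theorem rat_sq (m v α : ℝ) (hv : 0 < v) (h0 : 0 ≤ α) (h1 : α < 1) :
    Integrable (fun x => rat m v ((1 + α) * v) x ^ 2) (gaussianReal m v.toNNReal) ∧
    ∫ x, rat m v ((1 + α) * v) x ^ 2 ∂(gaussianReal m v.toNNReal) = (Real.sqrt (1 - α ^ 2))⁻¹ := by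
  have h1' : 0 < 1 - α := by linarith
  have h2' : 0 < 1 + α := by linarith
  have hu : 0 < (1 + α) / (1 - α) * v := by positivity
  have hw : 0 < (1 + α) * v := by positivity
  have key : ∀ x, rat m v ((1 + α) * v) x ^ 2
      = (Real.sqrt (1 - α ^ 2))⁻¹ * rat m v ((1 + α) / (1 - α) * v) x := by
    intro x
    unfold rat
    have hp := gaussianPDFReal_pos m v.toNNReal x (by simpa using hv)
    rw [div_pow, ← mul_div_assoc, div_eq_div_iff (by positivity) (by positivity), pow_two (gaussianPDFReal m v.toNNReal x), pow_two (gaussianPDFReal _ _ _),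
      ← mul_assoc (_ * _) (gaussianPDFReal m v.toNNReal x) (gaussianPDFReal m v.toNNReal x)]
    congr 1
    simp only [gaussianPDFReal, Real.coe_toNNReal _ hv.le, Real.coe_toNNReal _ hw.le,
      Real.coe_toNNReal _ hu.le]
    have hE : Real.exp (-(x - m) ^ 2 / (2 * ((1 + α) * v))) * Real.exp (-(x - m) ^ 2 / (2 * ((1 + α) * v)))
      = Real.exp (-(x - m) ^ 2 / (2 * ((1 + α) / (1 - α) * v))) * Real.exp (-(x - m) ^ 2 / (2 * v)) := by
      rw [← Real.exp_add, ← Real.exp_add]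
      congr 1
      field_simp
      ring
    have hC : (Real.sqrt (2 * Real.pi * ((1 + α) * v)))⁻¹ * (Real.sqrt (2 * Real.pi * ((1 + α) * v)))⁻¹
      = (Real.sqrt (1 - α ^ 2))⁻¹ * (Real.sqrt (2 * Real.pi * ((1 + α) / (1 - α) * v)))⁻¹ *
        (Real.sqrt (2 * Real.pi * v))⁻¹ := by
      have h3 : 0 < 1 - α ^ 2 := by nlinarith
      simp only [← Real.sqrt_inv]
      rw [← Real.sqrt_mul (by positivity), ← Real.sqrt_mul (by positivity), ← Real.sqrt_mul (by positivity)]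
      congr 1
      have : 1 - α ^ 2 = (1 - α) * (1 + α) := by ring
      rw [this]
      field_simp
    rw [mul_mul_mul_comm, hE, hC]
    ring
  simp_rw [key]
  refine ⟨(rat_int _ _ _ hv hu).const_mul _, ?_⟩
  rw [integral_const_mul]
  have : ∫ x, rat m v ((1 + α) / (1 - α) * v) x ∂(gaussianReal m v.toNNReal) = 1 := by
    rw [integral_eq_lintegral_of_nonneg_ae (Filter.Eventually.of_forall (rat_nonneg _ _ _))
      (rat_meas _ _ _).aestronglyMeasurable,
      ← setLIntegral_univ, ← withDensity_apply _ MeasurableSet.univ, ← rat_wd m v _ hv hu]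
    simp
  rw [this, mul_one]

theorem sqrt_add_le' {a b : ℝ} (ha : 0 ≤ a) (hb : 0 ≤ b) :
    Real.sqrt (a + b) ≤ Real.sqrt a + Real.sqrt b := by
  apply Real.sqrt_le_iff.2
  refine ⟨by positivity, ?_⟩
  nlinarith [Real.sq_sqrt ha, Real.sq_sqrt hb, mul_nonneg (Real.sqrt_nonneg a) (Real.sqrt_nonneg b)]

theorem num_bd (n : ℕ) (α : ℝ) (h0 : 0 ≤ α) (h1 : α ≤ 1 / (n + 2)) :
    Real.sqrt ((Real.sqrt (1 - α ^ 2))⁻¹ ^ n - 1)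
      ≤ Real.sqrt n * α / Real.sqrt 2 + Real.sqrt (n + n ^ 2) * α ^ ((3 : ℝ) / 2) := by
  have hn : (0 : ℝ) ≤ n := Nat.cast_nonneg n
  have ha : α ≤ 1 / 2 := h1.trans (by gcongr; linarith)
  have hna : n * α ≤ 1 := by
    rw [le_div_iff₀ (by positivity)] at h1
    nlinarith
  set x := α ^ 2 with hx
  have hx0 : 0 ≤ x := by positivity
  have hx1 : x ≤ 1 / 4 := by nlinarith
  have hc : (Real.sqrt (1 - x))⁻¹ ≤ 1 + (x / 2 + x ^ 2) := by
    rw [← Real.sqrt_inv]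
    apply Real.sqrt_le_iff.2
    refine ⟨by positivity, ?_⟩
    rw [inv_le_iff_one_le_mul₀ (by linarith)]
    nlinarith [mul_nonneg hx0 hx0, mul_nonneg (mul_nonneg hx0 hx0) hx0,
      mul_nonneg (mul_nonneg hx0 hx0) (sub_nonneg.2 hx1),
      mul_nonneg (mul_nonneg (mul_nonneg hx0 hx0) hx0) (sub_nonneg.2 hx1),
      mul_nonneg (mul_nonneg (mul_nonneg (mul_nonneg hx0 hx0) hx0) hx0) (sub_nonneg.2 hx1)]
  have hc2 : (Real.sqrt (1 - x))⁻¹ ^ n ≤ Real.exp (n * (x / 2 + x ^ 2)) := by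
    rw [Real.exp_nat_mul]
    gcongr
    refine hc.trans ?_
    linarith [Real.add_one_le_exp (x / 2 + x ^ 2)]
  have hnx : n * x ≤ 1 := by nlinarith
  have ht0 : 0 ≤ n * (x / 2 + x ^ 2) := by positivity
  have ht : n * (x / 2 + x ^ 2) ≤ n * x := by
    gcongr; nlinarith
  have h3 := (abs_le.1 (Real.abs_exp_sub_one_sub_id_le (x := n * (x / 2 + x ^ 2))
    (by rw [abs_of_nonneg ht0]; linarith))).2
  have h4 : (n * (x / 2 + x ^ 2)) ^ 2 ≤ (n * x) ^ 2 := by gcongr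
  have h5 : (Real.sqrt (1 - x))⁻¹ ^ n - 1 ≤ n * α ^ 2 / 2 + (n + n ^ 2) * x ^ 2 := by
    rw [← hx]; nlinarith
  have h6 : Real.sqrt ((Real.sqrt (1 - x))⁻¹ ^ n - 1)
      ≤ Real.sqrt (n * α ^ 2 / 2) + Real.sqrt ((n + n ^ 2) * x ^ 2) := 
    (Real.sqrt_le_sqrt h5).trans (sqrt_add_le' (by positivity) (by positivity))
  refine h6.trans ?_
  rw [Real.sqrt_div (by positivity), Real.sqrt_mul hn, Real.sqrt_sq h0, Real.sqrt_mul (by positivity),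
    Real.sqrt_sq hx0]
  gcongr
  rw [hx]
  rcases h0.eq_or_lt with rfl | h0
  · norm_num
  rw [← Real.rpow_natCast]
  exact Real.rpow_le_rpow_of_exponent_ge h0 (by linarith) (by norm_num)

/-- **Second bias bound (Proposition 3).**
For `α ≥ 0` let `Y_α ~ N(θ, (1+α) σ² Iₙ)` and `Risk_α(g) = E‖θ - g(Y_α)‖²`.  Under second
and fourth moment conditions on `g` (for `m = 0, 1`), there are `C > 0` and
`α₀ ∈ (0, β)` such that for all `α ∈ [0, α₀)`:
`|Risk_α(g) - Risk(g)| ≤ (√n α/√2) √Var(‖θ - g(Y)‖²) + C α^{3/2}` where `Y = Y₀`. -/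
theorem cb_bias_second_bound
    {n : ℕ} (θ : Fin n → ℝ) (σ2 : ℝ) (hσ2 : 0 < σ2)
    (g : (Fin n → ℝ) → (Fin n → ℝ)) (hg : Measurable g)
    (β : ℝ) (hβ : 0 < β)
    (hmom2 : ∀ m : ℕ, m ≤ 1 →
      Integrable (fun y => (∑ i, (g y i) ^ 2) * (∑ i, (y i - θ i) ^ 2) ^ m)
        (gaussianPi n θ ((1 + β) * σ2)))
    (hmom4 : ∀ m : ℕ, m ≤ 1 →
      Integrable (fun y => (∑ i, (g y i) ^ 2) ^ 2 * (∑ i, (y i - θ i) ^ 2) ^ m)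
        (gaussianPi n θ ((1 + β) * σ2))) :
    ∃ C > (0 : ℝ), ∃ α0 ∈ Set.Ioo (0 : ℝ) β, ∀ α ∈ Set.Ico (0 : ℝ) α0,
      |(∫ y, ∑ i, (θ i - g y i) ^ 2 ∂(gaussianPi n θ ((1 + α) * σ2)))
          - ∫ y, ∑ i, (θ i - g y i) ^ 2 ∂(gaussianPi n θ ((1 + 0) * σ2))|
        ≤ (Real.sqrt n * α / Real.sqrt 2)
            * Real.sqrt (varUnder (gaussianPi n θ ((1 + 0) * σ2))
                (fun y => ∑ i, (θ i - g y i) ^ 2))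
          + C * α ^ ((3 : ℝ) / 2) := by
  have hβ' : 0 < (1 + β) * σ2 := by positivity
  rw [show (1 + 0) * σ2 = σ2 by ring]
  have hprob : ∀ v, IsProbabilityMeasure (gaussianPi n θ v) := fun v => by
    unfold gaussianPi; infer_instance
  set μ := gaussianPi n θ σ2 with hμ
  have hgm : ∀ i, Measurable fun y => g y i := fun i => (measurable_pi_apply i).comp hg
  have hGm : Measurable (fun y => ∑ i, (g y i) ^ 2) :=
    Finset.measurable_sum _ fun i _ => (hgm i).pow_const 2
  set f : (Fin n → ℝ) → ℝ := fun y => ∑ i, (θ i - g y i) ^ 2 with hf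
  have hfm : Measurable f :=
    Finset.measurable_sum _ fun i _ => ((hgm i).const_sub _).pow_const 2
  have hG : MemLp (fun y => ∑ i, (g y i) ^ 2) 2 (gaussianPi n θ ((1 + β) * σ2)) := by
    rw [memLp_two_iff_integrable_sq hGm.aestronglyMeasurable]
    simpa using hmom4 0 (by norm_num)
  have hle : μ ≤ ENNReal.ofReal (∏ _i : Fin n, Real.sqrt ((1 + β) * σ2 / σ2)) •
      gaussianPi n θ ((1 + β) * σ2) := by
    rw [hμ, gpi_wd θ ((1 + β) * σ2) σ2 hβ' hσ2, ← withDensity_const]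
    apply withDensity_mono
    refine Filter.Eventually.of_forall fun x => ?_
    apply ENNReal.ofReal_le_ofReal
    refine Finset.prod_le_prod (fun i _ => rat_nonneg _ _ _ _) fun i _ => ?_
    exact rat_le _ _ _ hσ2 (by nlinarith) _
  have hG' : MemLp (fun y => ∑ i, (g y i) ^ 2) 2 μ :=
    hG.of_measure_le_smul ENNReal.ofReal_ne_top hle
  have hf2 : MemLp f 2 μ := by
    refine MemLp.mono' (g := fun y => 2 * ((∑ i, θ i ^ 2) + ∑ i, (g y i) ^ 2)) ?_
      hfm.aestronglyMeasurable (Filter.Eventually.of_forall fun y => ?_)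
    · have hc : MemLp (fun _ : Fin n → ℝ => ∑ i, θ i ^ 2) 2 μ := memLp_const _
      have hs : MemLp (fun y => (∑ i, θ i ^ 2) + ∑ i, (g y i) ^ 2) 2 μ := hc.add hG'
      exact hs.const_mul 2
    · rw [Real.norm_of_nonneg (Finset.sum_nonneg fun i _ => sq_nonneg _), ← Finset.sum_add_distrib,
        Finset.mul_sum]
      refine Finset.sum_le_sum fun i _ => ?_
      nlinarith [sq_nonneg (θ i + g y i)]
  have hfi : Integrable f μ := hf2.integrable (by norm_num)
  set V := varUnder μ f with hV
  have hn0 : (0 : ℝ) < n + 2 := by positivity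
  refine ⟨Real.sqrt V * Real.sqrt (n + n ^ 2) + 1, by positivity, min (β / 2) (1 / (n + 2)),
    ⟨by positivity, (min_le_left _ _).trans_lt (by linarith)⟩, ?_⟩
  rintro α ⟨h0, hα⟩
  have hα2 : α ≤ 1 / (n + 2) := (hα.trans_le (min_le_right _ _)).le
  have hα1 : α < 1 := by
    refine hα2.trans_lt ?_
    rw [div_lt_one hn0]
    have : (0 : ℝ) ≤ n := Nat.cast_nonneg n
    linarith
  have hw : 0 < (1 + α) * σ2 := by positivity
  set L : (Fin n → ℝ) → ℝ := fun x => ∏ i, rat (θ i) σ2 ((1 + α) * σ2) (x i) with hL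
  have hLm : Measurable L :=
    Finset.measurable_prod _ fun i _ => (rat_meas _ _ _).comp (measurable_pi_apply i)
  have hL0 : ∀ x, 0 ≤ L x := fun x => Finset.prod_nonneg fun i _ => rat_nonneg _ _ _ _
  have hwd : gaussianPi n θ ((1 + α) * σ2) = μ.withDensity (fun x => ENNReal.ofReal (L x)) :=
    gpi_wd θ σ2 _ hσ2 hw
  have hch : ∀ h : (Fin n → ℝ) → ℝ, ∫ y, h y ∂(gaussianPi n θ ((1 + α) * σ2)) = ∫ y, L y * h y ∂μ := by
    intro h
    rw [hwd, integral_withDensity_eq_integral_toReal_smul hLm.ennreal_ofReal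
      (Filter.Eventually.of_forall fun x => ENNReal.ofReal_lt_top)]
    refine integral_congr_ae (Filter.Eventually.of_forall fun x => ?_)
    simp [ENNReal.toReal_ofReal (hL0 x)]
  have hL1 : ∫ y, L y ∂μ = 1 := by
    have := hch (fun _ => 1)
    simpa using this.symm
  have hLsq : ∀ x, L x ^ 2 = ∏ i, rat (θ i) σ2 ((1 + α) * σ2) (x i) ^ 2 := fun x => by
    rw [hL, Finset.prod_pow]
  have hLi2 : Integrable (fun x => L x ^ 2) μ := by
    simp_rw [hLsq]
    exact Integrable.fintype_prod (f := fun i x => rat (θ i) σ2 ((1 + α) * σ2) x ^ 2)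
      (fun i => (rat_sq (θ i) σ2 α hσ2 h0 hα1).1)
  have hLe2 : ∫ x, L x ^ 2 ∂μ = (Real.sqrt (1 - α ^ 2))⁻¹ ^ n := by
    simp_rw [hLsq]
    rw [hμ, gaussianPi, integral_fintype_prod_eq_prod
      (f := fun i x => rat (θ i) σ2 ((1 + α) * σ2) x ^ 2)]
    simp_rw [fun i => (rat_sq (θ i) σ2 α hσ2 h0 hα1).2]
    simp
  have hL2 : MemLp L 2 μ := (memLp_two_iff_integrable_sq hLm.aestronglyMeasurable).2 hLi2
  have hLi : Integrable L μ := hL2.integrable (by norm_num)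
  have hLf : Integrable (fun x => L x * f x) μ := hL2.integrable_mul hf2
  have hcs := cs_int μ (fun x => f x - ∫ y, f y ∂μ) (fun x => L x - 1)
    (hf2.sub (memLp_const _)) (hL2.sub (memLp_const _))
  have hA : ∫ x, (f x - ∫ y, f y ∂μ) * (L x - 1) ∂μ = (∫ x, L x * f x ∂μ) - ∫ x, f x ∂μ := by
    have e : ∀ x, (f x - ∫ y, f y ∂μ) * (L x - 1)
        = (L x * f x - f x) - (∫ y, f y ∂μ) * (L x - 1) := fun x => by ring
    simp_rw [e]
    have i1 : Integrable (fun x => L x * f x - f x) μ := hLf.sub hfi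
    have i2 : Integrable (fun x => L x - 1) μ := hLi.sub (integrable_const _)
    rw [integral_sub i1 (i2.const_mul _),
      integral_sub hLf hfi, integral_const_mul, integral_sub hLi (integrable_const _), hL1]
    simp
  have hB : ∫ x, (L x - 1) * (L x - 1) ∂μ = (Real.sqrt (1 - α ^ 2))⁻¹ ^ n - 1 := by
    have e : ∀ x, (L x - 1) * (L x - 1) = (L x ^ 2 - 2 * L x) + 1 := fun x => by ring
    simp_rw [e]
    have i1 : Integrable (fun x => L x ^ 2 - 2 * L x) μ := hLi2.sub (hLi.const_mul 2)
    rw [integral_add i1 (integrable_const _),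
      integral_sub hLi2 (hLi.const_mul 2), integral_const_mul, hL1, hLe2]
    simp
    ring
  rw [hA, hB] at hcs
  rw [hch]
  refine hcs.trans ?_
  change Real.sqrt V * _ ≤ _
  have hp : 0 ≤ α ^ ((3 : ℝ) / 2) := Real.rpow_nonneg h0 _
  have := mul_le_mul_of_nonneg_left (num_bd n α h0 hα2) (Real.sqrt_nonneg V)
  nlinarith
end

section
/- Let A be an n x n symmetric positive definite real matrix and define ||x||_A^2 = x^T A^{-1} x for x in R^n. Let U, V, W be independent random vectors in R^n with E||U||_A^2, E||V||_A^2, E||W||_A^2 finite, and let g : R^n -> R^n be measurable with E||g(U)||_A^2 < infinity. Then E||V - g(U)||_A^2 - E||W - g(U)||_A^2 = E||V||_A^2 - E||W||_A^2 + 2 <A^{-1} E[g(U)], E[W] - E[V]>. In particular, if E[V] = E[W] and U, V are identically distributed, then E||V - g(U)||_A^2 = E||W - g(U)||_A^2 + E||U||_A^2 - E||W||_A^2. -/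
open MeasureTheory ProbabilityTheory Matrix

lemma tp_cs {n : ℕ} (A : Matrix (Fin n) (Fin n) ℝ) (hA : A.PosDef) (x : Fin n → ℝ) (i : Fin n) :
    x i ^ 2 ≤ A i i * (x ⬝ᵥ A⁻¹.mulVec x) := by
  have hd : 0 < A i i := hA.diag_pos
  have hu : IsUnit A.det := hA.det_pos.ne'.isUnit
  have hs : A⁻¹ᵀ = A⁻¹ := by
    have := hA.inv.isHermitian
    simpa [Matrix.IsHermitian, Matrix.conjTranspose_eq_transpose_of_trivial] using this
  set e : Fin n → ℝ := Pi.single i 1 with he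
  set y := A.mulVec e with hy
  have h1 : A⁻¹.mulVec y = e := by
    rw [hy, Matrix.mulVec_mulVec, Matrix.nonsing_inv_mul _ hu, Matrix.one_mulVec]
  have h2 : y ⬝ᵥ A⁻¹.mulVec x = x i := by
    rw [Matrix.dotProduct_mulVec, ← Matrix.mulVec_transpose, hs, h1, he]
    simp
  have h3 : y ⬝ᵥ e = A i i := by
    simp [hy, he]
  have h4 : x ⬝ᵥ e = x i := by simp [he]
  set t := x i / A i i with ht
  have h5 : 0 ≤ (x - t • y) ⬝ᵥ A⁻¹.mulVec (x - t • y) := by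
    have := hA.inv.posSemidef.dotProduct_mulVec_nonneg (x - t • y)
    simpa using this
  rw [Matrix.mulVec_sub, Matrix.mulVec_smul, h1] at h5
  simp only [sub_dotProduct, dotProduct_sub, smul_dotProduct, dotProduct_smul, h2, h3, h4,
    smul_eq_mul] at h5
  have h6 : t * A i i = x i := by rw [ht]; field_simp
  nlinarith

lemma tp_key {Ω : Type*} [MeasurableSpace Ω] {μ : Measure Ω} [IsProbabilityMeasure μ]
    {n : ℕ} (A : Matrix (Fin n) (Fin n) ℝ) (hA : A.PosDef)
    (X Y : Ω → (Fin n → ℝ)) (hX : Measurable X) (hY : Measurable Y)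
    (hI : IndepFun Y X μ)
    (hX2 : Integrable (fun ω => X ω ⬝ᵥ A⁻¹.mulVec (X ω)) μ)
    (hY2 : Integrable (fun ω => Y ω ⬝ᵥ A⁻¹.mulVec (Y ω)) μ) :
    (∫ ω, (fun i => X ω i - Y ω i) ⬝ᵥ A⁻¹.mulVec (fun i => X ω i - Y ω i) ∂μ)
     = (∫ ω, X ω ⬝ᵥ A⁻¹.mulVec (X ω) ∂μ) + (∫ ω, Y ω ⬝ᵥ A⁻¹.mulVec (Y ω) ∂μ)
       - 2 * ((A⁻¹.mulVec fun i => ∫ ω, Y ω i ∂μ) ⬝ᵥ fun i => ∫ ω, X ω i ∂μ) := by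
  have hs : A⁻¹ᵀ = A⁻¹ := by
    have := hA.inv.isHermitian
    simpa [Matrix.IsHermitian, Matrix.conjTranspose_eq_transpose_of_trivial] using this
  have hint : ∀ Z : Ω → (Fin n → ℝ), Measurable Z →
      Integrable (fun ω => Z ω ⬝ᵥ A⁻¹.mulVec (Z ω)) μ → ∀ i, Integrable (fun ω => Z ω i) μ := by
    intro Z hZ hZ2 i
    have hm : Measurable (fun ω => Z ω i) := (measurable_pi_apply i).comp hZ
    have : MemLp (fun ω => Z ω i) 2 μ := by
      rw [memLp_two_iff_integrable_sq hm.aestronglyMeasurable]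
      refine (hZ2.const_mul (A i i)).mono' (hm.pow_const 2).aestronglyMeasurable ?_
      filter_upwards with ω
      rw [Real.norm_of_nonneg (sq_nonneg _)]
      exact tp_cs A hA _ i
    exact this.integrable (by norm_num)
  have hXi := hint X hX hX2
  have hYi := hint Y hY hY2
  have hIij : ∀ i j, IndepFun (fun ω => Y ω j) (fun ω => X ω i) μ := fun i j =>
    hI.comp (measurable_pi_apply j) (measurable_pi_apply i)
  have hprod : ∀ i j, Integrable (fun ω => Y ω j * X ω i) μ := fun i j =>
    (hIij i j).integrable_mul (hYi j) (hXi i)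
  have hmul : ∀ i j, ∫ ω, Y ω j * X ω i ∂μ = (∫ ω, Y ω j ∂μ) * ∫ ω, X ω i ∂μ := fun i j =>
    (hIij i j).integral_fun_mul_eq_mul_integral (hYi j).aestronglyMeasurable
      (hXi i).aestronglyMeasurable
  have hdp : ∀ x y : Fin n → ℝ, A⁻¹.mulVec y ⬝ᵥ x = ∑ i, ∑ j, A⁻¹ i j * (y j * x i) := by
    intro x y
    simp only [dotProduct, mulVec, Finset.sum_mul, mul_assoc]
  have hci : Integrable (fun ω => ∑ i, ∑ j, A⁻¹ i j * (Y ω j * X ω i)) μ :=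
    integrable_finsetSum _ fun i _ => integrable_finsetSum _ fun j _ => (hprod i j).const_mul _
  have hpt : ∀ ω, (fun i => X ω i - Y ω i) ⬝ᵥ A⁻¹.mulVec (fun i => X ω i - Y ω i)
      = X ω ⬝ᵥ A⁻¹.mulVec (X ω) + Y ω ⬝ᵥ A⁻¹.mulVec (Y ω)
        - 2 * ∑ i, ∑ j, A⁻¹ i j * (Y ω j * X ω i) := by
    intro ω
    rw [← hdp]
    change (X ω - Y ω) ⬝ᵥ A⁻¹.mulVec (X ω - Y ω) = _
    have h1 : Y ω ⬝ᵥ A⁻¹.mulVec (X ω) = A⁻¹.mulVec (Y ω) ⬝ᵥ X ω := by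
      rw [Matrix.dotProduct_mulVec, ← Matrix.mulVec_transpose, hs]
    have h2 : X ω ⬝ᵥ A⁻¹.mulVec (Y ω) = A⁻¹.mulVec (Y ω) ⬝ᵥ X ω := dotProduct_comm _ _
    simp only [Matrix.mulVec_sub, sub_dotProduct, dotProduct_sub, h1, h2]
    ring
  simp_rw [hpt]
  have hadd : Integrable (fun ω => X ω ⬝ᵥ A⁻¹.mulVec (X ω) + Y ω ⬝ᵥ A⁻¹.mulVec (Y ω)) μ :=
    hX2.add hY2
  rw [integral_sub hadd (hci.const_mul 2), integral_add hX2 hY2, integral_const_mul, hdp]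
  congr 2
  refine (integral_finsetSum _ fun i _ =>
    integrable_finsetSum _ fun j _ => (hprod i j).const_mul (A⁻¹ i j)).trans ?_
  refine Finset.sum_congr rfl fun i _ => ?_
  refine (integral_finsetSum _ fun j _ => (hprod i j).const_mul (A⁻¹ i j)).trans ?_
  refine Finset.sum_congr rfl fun j _ => ?_
  rw [integral_const_mul, hmul]

/-- **Three-point formula for a generalized quadratic loss (Proposition 6).**
Let `A` be symmetric positive definite with `‖x‖_A² = xᵀ A⁻¹ x`.  For mutually independent
random vectors `U, V, W` with finite `A`-quadratic second moments and measurable `g` with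
`E‖g(U)‖_A² < ∞`:
`E‖V - g(U)‖_A² - E‖W - g(U)‖_A² = E‖V‖_A² - E‖W‖_A² + 2 ⟨A⁻¹ E[g(U)], E[W] - E[V]⟩`;
and if moreover `E[V] = E[W]` and `U, V` are identically distributed, then
`E‖V - g(U)‖_A² = E‖W - g(U)‖_A² + E‖U‖_A² - E‖W‖_A²`. -/
theorem three_point_formula_quadratic_norm
    {Ω : Type*} [MeasurableSpace Ω] {μ : Measure Ω} [IsProbabilityMeasure μ]
    {n : ℕ} (A : Matrix (Fin n) (Fin n) ℝ) (hA : A.PosDef)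
    (U V W : Ω → (Fin n → ℝ))
    (hUm : Measurable U) (hVm : Measurable V) (hWm : Measurable W)
    (hIndep : iIndepFun ![U, V, W] μ)
    (hU2 : Integrable (fun ω => U ω ⬝ᵥ A⁻¹.mulVec (U ω)) μ)
    (hV2 : Integrable (fun ω => V ω ⬝ᵥ A⁻¹.mulVec (V ω)) μ)
    (hW2 : Integrable (fun ω => W ω ⬝ᵥ A⁻¹.mulVec (W ω)) μ)
    (g : (Fin n → ℝ) → (Fin n → ℝ)) (hg : Measurable g)
    (hgU : Integrable (fun ω => g (U ω) ⬝ᵥ A⁻¹.mulVec (g (U ω))) μ) :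
    ((∫ ω, (fun i => V ω i - g (U ω) i) ⬝ᵥ A⁻¹.mulVec (fun i => V ω i - g (U ω) i) ∂μ)
        - (∫ ω, (fun i => W ω i - g (U ω) i) ⬝ᵥ A⁻¹.mulVec (fun i => W ω i - g (U ω) i) ∂μ)
      = (∫ ω, V ω ⬝ᵥ A⁻¹.mulVec (V ω) ∂μ) - (∫ ω, W ω ⬝ᵥ A⁻¹.mulVec (W ω) ∂μ)
        + 2 * ((A⁻¹.mulVec fun i => ∫ ω, g (U ω) i ∂μ)
            ⬝ᵥ fun i => (∫ ω, W ω i ∂μ) - ∫ ω, V ω i ∂μ))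
    ∧ ((∀ i, (∫ ω, V ω i ∂μ) = ∫ ω, W ω i ∂μ) → Measure.map U μ = Measure.map V μ →
        (∫ ω, (fun i => V ω i - g (U ω) i) ⬝ᵥ A⁻¹.mulVec (fun i => V ω i - g (U ω) i) ∂μ)
          = (∫ ω, (fun i => W ω i - g (U ω) i) ⬝ᵥ A⁻¹.mulVec (fun i => W ω i - g (U ω) i) ∂μ)
            + (∫ ω, U ω ⬝ᵥ A⁻¹.mulVec (U ω) ∂μ)
            - ∫ ω, W ω ⬝ᵥ A⁻¹.mulVec (W ω) ∂μ) := by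
  have hUV : IndepFun U V μ := by
    simpa using hIndep.indepFun (i := (0 : Fin 3)) (j := 1) (by decide)
  have hUW : IndepFun U W μ := by
    simpa using hIndep.indepFun (i := (0 : Fin 3)) (j := 2) (by decide)
  have kV := tp_key A hA V (fun ω => g (U ω)) hVm (hg.comp hUm)
    (hUV.comp hg measurable_id) hV2 hgU
  have kW := tp_key A hA W (fun ω => g (U ω)) hWm (hg.comp hUm)
    (hUW.comp hg measurable_id) hW2 hgU
  have hsub : ((A⁻¹.mulVec fun i => ∫ ω, g (U ω) i ∂μ)
            ⬝ᵥ fun i => (∫ ω, W ω i ∂μ) - ∫ ω, V ω i ∂μ)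
      = ((A⁻¹.mulVec fun i => ∫ ω, g (U ω) i ∂μ) ⬝ᵥ fun i => (∫ ω, W ω i ∂μ))
        - ((A⁻¹.mulVec fun i => ∫ ω, g (U ω) i ∂μ) ⬝ᵥ fun i => (∫ ω, V ω i ∂μ)) :=
    dotProduct_sub _ _ _
  refine ⟨by rw [kV, kW, hsub]; ring, fun hE hD => ?_⟩
  have hq : Measurable (fun x : Fin n → ℝ => x ⬝ᵥ A⁻¹.mulVec x) := by
    simp only [dotProduct, mulVec]
    fun_prop
  have hUVq : (∫ ω, U ω ⬝ᵥ A⁻¹.mulVec (U ω) ∂μ) = ∫ ω, V ω ⬝ᵥ A⁻¹.mulVec (V ω) ∂μ := by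
    rw [← integral_map (φ := U) (f := fun x : Fin n → ℝ => x ⬝ᵥ A⁻¹.mulVec x) hUm.aemeasurable
      hq.aestronglyMeasurable, hD, integral_map hVm.aemeasurable hq.aestronglyMeasurable]
  rw [kV, kW, hUVq]
  simp_rw [hE]
  ring
end

section
/- Let Sigma be an n x n symmetric positive definite matrix and let Y ~ N(theta, Sigma) with theta in R^n. Let A be an n x n symmetric positive definite matrix and define ||x||_A^2 = x^T A^{-1} x. Fix alpha > 0 and an integer B >= 1, let omega^1, ..., omega^B be i.i.d. N(0, Sigma) independent of Y, and set Y^{*b} = Y + sqrt(alpha) omega^b and Y^{dagger b} = Y - omega^b / sqrt(alpha). Let g : R^n -> R^n be measurable with E||g(Y_alpha)||_A^2 < infinity, where Y_alpha ~ N(theta, (1+alpha) Sigma). Define CB_{A,alpha}(g) = (1/B) sum_{b=1}^B ( ||Y^{dagger b} - g(Y^{*b})||_A^2 - ||omega^b||_A^2 / alpha ) - tr(A^{-1} Sigma). Then E[CB_{A,alpha}(g)] = E||theta - g(Y_alpha)||_A^2. -/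
open MeasureTheory ProbabilityTheory Matrix

/-- The positive semidefinite square root of a real positive semidefinite matrix (the
definition of the older Mathlib, since removed there). -/
noncomputable def Matrix.PosSemidef.sqrt {n : Type*} [Fintype n] [DecidableEq n]
    {A : Matrix n n ℝ} (hA : A.PosSemidef) : Matrix n n ℝ :=
  hA.1.eigenvectorUnitary.1 * Matrix.diagonal (Real.sqrt ∘ hA.1.eigenvalues) *
    (star hA.1.eigenvectorUnitary : Matrix n n ℝ)

/-- The multivariate Gaussian distribution `N(m, S)` on `ℝⁿ`, realized as the pushforward
of a standard Gaussian vector `z` under `z ↦ m + √S z`, where `√S` is the positive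
semidefinite square root of `S`. -/
noncomputable def mvGaussian {n : ℕ} (m : Fin n → ℝ) (S : Matrix (Fin n) (Fin n) ℝ)
    (hS : S.PosSemidef) : Measure (Fin n → ℝ) :=
  Measure.map (fun z => m + hS.sqrt.mulVec z)
    (Measure.pi fun _ : Fin n => gaussianReal 0 1)

open scoped MatrixOrder in
lemma cb_sqrt_eq {n : ℕ} {S : Matrix (Fin n) (Fin n) ℝ} (hS : S.PosSemidef) :
    CFC.sqrt S = hS.sqrt := by
  apply CFC.sqrt_unique
  · have h := hS.1.spectral_theorem
    have hu : (star hS.1.eigenvectorUnitary : Matrix (Fin n) (Fin n) ℝ) *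
      hS.1.eigenvectorUnitary.1 = 1 := by simp
    have hd : Matrix.diagonal (Real.sqrt ∘ hS.1.eigenvalues) *
        Matrix.diagonal (Real.sqrt ∘ hS.1.eigenvalues) = Matrix.diagonal hS.1.eigenvalues := by
      rw [Matrix.diagonal_mul_diagonal]
      congr 1
      ext i
      exact Real.mul_self_sqrt (hS.eigenvalues_nonneg i)
    conv_rhs => rw [h]
    unfold Matrix.PosSemidef.sqrt
    calc _ = hS.1.eigenvectorUnitary.1 * (Matrix.diagonal (Real.sqrt ∘ hS.1.eigenvalues) *
        ((star hS.1.eigenvectorUnitary : Matrix (Fin n) (Fin n) ℝ) *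
      hS.1.eigenvectorUnitary.1) * Matrix.diagonal (Real.sqrt ∘ hS.1.eigenvalues)) * 
        (star hS.1.eigenvectorUnitary : Matrix (Fin n) (Fin n) ℝ) := by
          simp only [Matrix.mul_assoc]
      _ = _ := by
        rw [hu, Matrix.mul_one, hd]
        simp [Unitary.conjStarAlgAut_apply]
  · rw [Matrix.nonneg_iff_posSemidef]
    unfold Matrix.PosSemidef.sqrt
    have : (Matrix.diagonal (Real.sqrt ∘ hS.1.eigenvalues)).PosSemidef :=
      Matrix.PosSemidef.diagonal (fun i => Real.sqrt_nonneg _)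
    exact this.mul_mul_conjTranspose_same hS.1.eigenvectorUnitary.1

lemma cb_mvGaussian_eq {n : ℕ} (m : Fin n → ℝ) {S : Matrix (Fin n) (Fin n) ℝ}
    (hS : S.PosSemidef) : mvGaussian m S hS =
      (multivariateGaussian (WithLp.toLp 2 m) S).map WithLp.ofLp := by
  unfold mvGaussian multivariateGaussian
  rw [← map_pi_eq_stdGaussian, Measure.map_map (by fun_prop) (by fun_prop),
    Measure.map_map (by fun_prop) (by fun_prop), cb_sqrt_eq hS]
  congr 1

lemma cb_isGaussian {n : ℕ} (m : Fin n → ℝ) {S : Matrix (Fin n) (Fin n) ℝ}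
    (hS : S.PosSemidef) : IsGaussian (mvGaussian m S hS) := by
  rw [cb_mvGaussian_eq]
  exact isGaussian_map_equiv (PiLp.continuousLinearEquiv 2 ℝ (fun _ : Fin n => ℝ))

lemma cb_mean {n : ℕ} (m : Fin n → ℝ) {S : Matrix (Fin n) (Fin n) ℝ}
    (hS : S.PosSemidef) (i : Fin n) : ∫ y, y i ∂(mvGaussian m S hS) = m i := by
  rw [cb_mvGaussian_eq, integral_map (by fun_prop)
    (Measurable.aestronglyMeasurable (by fun_prop))]
  have := (EuclideanSpace.proj (𝕜 := ℝ) i).integral_comp_id_comm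
    (μ := multivariateGaussian (WithLp.toLp 2 m) S) IsGaussian.integrable_id
  simpa using this

lemma cb_cov {n : ℕ} (m : Fin n → ℝ) {S : Matrix (Fin n) (Fin n) ℝ}
    (hS : S.PosSemidef) (i j : Fin n) :
    cov[fun y => y i, fun y => y j; mvGaussian m S hS] = S i j := by
  rw [cb_mvGaussian_eq, covariance_map (Measurable.aestronglyMeasurable (by fun_prop))
    (Measurable.aestronglyMeasurable (by fun_prop)) (by fun_prop)]
  exact covariance_eval_multivariateGaussian hS i j

lemma cb_ext {n : ℕ} (P Q : Measure (Fin n → ℝ)) [IsGaussian P] [IsGaussian Q]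
    (hm : ∀ i, ∫ y, y i ∂P = ∫ y, y i ∂Q)
    (hc : ∀ i j, cov[fun y => y i, fun y => y j; P] = cov[fun y => y i, fun y => y j; Q]) :
    P = Q := by
  have key : ∀ (ν : Measure (Fin n → ℝ)) [IsGaussian ν] (L : StrongDual ℝ (Fin n → ℝ)),
      ν[L] = ∑ i, L (Pi.single i 1) * (∫ y : Fin n → ℝ, y i ∂ν) ∧
      Var[L; ν] = ∑ i, ∑ j, L (Pi.single i 1) * (L (Pi.single j 1) *
        cov[fun y : Fin n → ℝ => y i, fun y => y j; ν]) := by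
    intro ν _ L
    have hL : (L : (Fin n → ℝ) → ℝ) = fun y => ∑ i, L (Pi.single i 1) * y i := by
      ext y
      conv_lhs => rw [pi_eq_sum_univ' y, map_sum]
      simp only [map_smul, smul_eq_mul]
      refine Finset.sum_congr rfl fun i _ => ?_
      rw [mul_comm]
    have hmem : ∀ i : Fin n, MemLp (fun y : Fin n → ℝ => y i) 2 ν := fun i =>
      (IsGaussian.memLp_two_id (μ := ν)).eval i
    constructor
    · conv_lhs => rw [hL]
      rw [integral_finsetSum _ fun i _ => ((hmem i).integrable (by norm_num)).const_mul _]
      simp only [integral_const_mul]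
    · conv_lhs => rw [hL]
      rw [variance_fun_sum (fun i => (hmem i).const_mul _)]
      simp only [covariance_const_mul_left, covariance_const_mul_right]
      exact Finset.sum_congr rfl fun i _ => Finset.sum_congr rfl fun j _ => by ring
  refine Measure.ext_of_charFunDual ?_
  ext L
  rw [IsGaussian.charFunDual_eq, IsGaussian.charFunDual_eq, integral_complex_ofReal,
    integral_complex_ofReal, (key P L).1, (key P L).2, (key Q L).1, (key Q L).2]
  simp only [hm, hc]

lemma cb_memLp_of_quad {n : ℕ} {X : Type*} [MeasurableSpace X] (P : Measure X)
    {M : Matrix (Fin n) (Fin n) ℝ} (hM : M.PosDef) (f : X → Fin n → ℝ) (hf : Measurable f)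
    (hint : Integrable (fun x => f x ⬝ᵥ M.mulVec (f x)) P) (i : Fin n) :
    MemLp (fun x => f x i) 2 P := by
  obtain ⟨C, rfl⟩ : ∃ C : Matrix (Fin n) (Fin n) ℝ, M = Cᴴ * C := by
    open scoped MatrixOrder in
    exact CStarAlgebra.nonneg_iff_eq_star_mul_self.1 hM.posSemidef.nonneg
  have hC : IsUnit C.det := by
    have := hM.det_pos
    rw [Matrix.det_mul] at this
    exact isUnit_iff_ne_zero.2 (right_ne_zero_of_mul this.ne')
  have hq : ∀ x, f x ⬝ᵥ (Cᴴ * C).mulVec (f x) = ∑ j, (C.mulVec (f x) j) ^ 2 := by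
    intro x
    rw [← Matrix.mulVec_mulVec, Matrix.dotProduct_mulVec, Matrix.conjTranspose_eq_transpose_of_trivial, Matrix.vecMul_transpose]
    simp [dotProduct, sq]
  have hmeas : ∀ j, Measurable (fun x => C.mulVec (f x) j) := by
    intro j
    simp only [Matrix.mulVec, dotProduct]
    fun_prop
  have h1 : ∀ j, MemLp (fun x => C.mulVec (f x) j) 2 P := by
    intro j
    rw [memLp_two_iff_integrable_sq (hmeas j).aestronglyMeasurable]
    refine hint.mono ((hmeas j).pow_const 2).aestronglyMeasurable (.of_forall fun x => ?_)
    rw [hq, Real.norm_of_nonneg (sq_nonneg _), Real.norm_of_nonneg (Finset.sum_nonneg fun _ _ => sq_nonneg _)]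
    exact Finset.single_le_sum (f := fun j => (C.mulVec (f x) j) ^ 2)
      (fun _ _ => sq_nonneg _) (Finset.mem_univ j)
  have h2 : (fun x => f x i) = fun x => ∑ j, C⁻¹ i j * C.mulVec (f x) j := by
    ext x
    have : f x = C⁻¹.mulVec (C.mulVec (f x)) := by
      rw [Matrix.mulVec_mulVec, Matrix.nonsing_inv_mul _ hC, Matrix.one_mulVec]
    conv_lhs => rw [this]
    rfl
  rw [h2]
  exact memLp_finsetSum _ fun j _ => (h1 j).const_mul _

lemma cb_quad {n : ℕ} (M : Matrix (Fin n) (Fin n) ℝ) (x : Fin n → ℝ) :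
    x ⬝ᵥ M.mulVec x = ∑ i, ∑ j, M i j * (x i * x j) := by
  simp only [dotProduct, Matrix.mulVec, Finset.mul_sum]
  exact Finset.sum_congr rfl fun i _ => Finset.sum_congr rfl fun j _ => by ring

lemma cb_single {Ω : Type*} [MeasurableSpace Ω] {μ : Measure Ω} [IsProbabilityMeasure μ]
    {n : ℕ} (θ : Fin n → ℝ)
    (Sig M : Matrix (Fin n) (Fin n) ℝ) (hSig : Sig.PosSemidef) (hM : M.PosDef)
    (α : ℝ) (hα : 0 < α) (hSiga : ((1 + α) • Sig).PosSemidef)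
    (Y w : Ω → (Fin n → ℝ)) (hY : Measurable Y) (hw : Measurable w)
    (hIndep : IndepFun Y w μ)
    (hYlaw : Measure.map Y μ = mvGaussian θ Sig hSig)
    (hwlaw : Measure.map w μ = mvGaussian 0 Sig hSig)
    (g : (Fin n → ℝ) → (Fin n → ℝ)) (hg : Measurable g)
    (hgint : Integrable (fun y => g y ⬝ᵥ M.mulVec (g y))
      (mvGaussian θ ((1 + α) • Sig) hSiga)) :
    Integrable (fun ω' => ((fun i => Y ω' i - w ω' i / Real.sqrt α
              - g (fun j => Y ω' j + Real.sqrt α * w ω' j) i)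
            ⬝ᵥ M.mulVec (fun i => Y ω' i - w ω' i / Real.sqrt α
              - g (fun j => Y ω' j + Real.sqrt α * w ω' j) i))
          - (w ω' ⬝ᵥ M.mulVec (w ω')) / α) μ ∧
    ∫ ω', (((fun i => Y ω' i - w ω' i / Real.sqrt α
              - g (fun j => Y ω' j + Real.sqrt α * w ω' j) i)
            ⬝ᵥ M.mulVec (fun i => Y ω' i - w ω' i / Real.sqrt α
              - g (fun j => Y ω' j + Real.sqrt α * w ω' j) i))
          - (w ω' ⬝ᵥ M.mulVec (w ω')) / α) ∂μ =
      (∫ y, (fun i => θ i - g y i) ⬝ᵥ M.mulVec (fun i => θ i - g y i)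
          ∂(mvGaussian θ ((1 + α) • Sig) hSiga)) + (M * Sig).trace := by
  have hs : 0 < Real.sqrt α := Real.sqrt_pos.2 hα
  have hss : Real.sqrt α * Real.sqrt α = α := Real.mul_self_sqrt hα.le
  set s := Real.sqrt α with hsdef
  have hgY : HasGaussianLaw Y μ := ⟨by rw [hYlaw]; exact cb_isGaussian θ hSig⟩
  have hgw : HasGaussianLaw w μ := ⟨by rw [hwlaw]; exact cb_isGaussian 0 hSig⟩
  have hYw := hIndep.hasGaussianLaw hgY hgw
  have mY : ∀ i, MemLp (fun ω => Y ω i) 2 μ := fun i => hgY.memLp_two.eval i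
  have mw : ∀ i, MemLp (fun ω => w ω i) 2 μ := fun i => hgw.memLp_two.eval i
  have EY : ∀ i, ∫ ω, Y ω i ∂μ = θ i := by
    intro i
    rw [← cb_mean θ hSig i, ← hYlaw, integral_map hY.aemeasurable
      (Measurable.aestronglyMeasurable (by fun_prop))]
  have Ew : ∀ i, ∫ ω, w ω i ∂μ = 0 := by
    intro i
    rw [← Pi.zero_apply (M := fun _ => ℝ) i, ← cb_mean 0 hSig i, ← hwlaw,
      integral_map hw.aemeasurable (Measurable.aestronglyMeasurable (by fun_prop))]
  have CY : ∀ i j, cov[fun ω => Y ω i, fun ω => Y ω j; μ] = Sig i j := by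
    intro i j
    rw [← cb_cov θ hSig i j, ← hYlaw, covariance_map
      (Measurable.aestronglyMeasurable (by fun_prop))
      (Measurable.aestronglyMeasurable (by fun_prop)) hY.aemeasurable]
    rfl
  have Cw : ∀ i j, cov[fun ω => w ω i, fun ω => w ω j; μ] = Sig i j := by
    intro i j
    rw [← cb_cov 0 hSig i j, ← hwlaw, covariance_map
      (Measurable.aestronglyMeasurable (by fun_prop))
      (Measurable.aestronglyMeasurable (by fun_prop)) hw.aemeasurable]
    rfl
  have CYw : ∀ i j, cov[fun ω => Y ω i, fun ω => w ω j; μ] = 0 := by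
    intro i j
    exact IndepFun.covariance_eq_zero (hIndep.comp (measurable_pi_apply i)
      (measurable_pi_apply j)) (mY i) (mw j)
  have CwY : ∀ i j, cov[fun ω => w ω i, fun ω => Y ω j; μ] = 0 := by
    intro i j
    rw [covariance_comm, CYw]
  -- general bilinear covariance
  have Cg : ∀ (a b : ℝ) (i j : Fin n),
      cov[fun ω => Y ω i + a * w ω i, fun ω => Y ω j + b * w ω j; μ] =
        (1 + a * b) * Sig i j := by
    intro a b i j
    change cov[(fun ω => Y ω i) + fun ω => a * w ω i, (fun ω => Y ω j) + fun ω => b * w ω j; μ] = _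
    rw [covariance_add_left (mY i) ((mw i).const_mul a) ((mY j).add ((mw j).const_mul b)),
      covariance_add_right (mY i) (mY j) ((mw j).const_mul b),
      covariance_add_right ((mw i).const_mul a) (mY j) ((mw j).const_mul b)]
    simp only [covariance_const_mul_left, covariance_const_mul_right, CY, Cw, CYw, CwY]
    ring
  have mg : ∀ (a : ℝ) (i : Fin n), MemLp (fun ω => Y ω i + a * w ω i) 2 μ :=
    fun a i => (mY i).add ((mw i).const_mul a)
  have Eg : ∀ (a : ℝ) (i : Fin n), ∫ ω, (Y ω i + a * w ω i) ∂μ = θ i := by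
    intro a i
    rw [integral_add ((mY i).integrable (by norm_num))
      (((mw i).integrable (by norm_num)).const_mul a), integral_const_mul, EY, Ew]
    simp
  let U : Ω → Fin n → ℝ := fun ω j => Y ω j + s * w ω j
  let V : Ω → Fin n → ℝ := fun ω j => Y ω j + (-s⁻¹) * w ω j
  have hU : Measurable U := by fun_prop
  have hUV : HasGaussianLaw (fun ω => (U ω, V ω)) μ := by
    let F := ContinuousLinearMap.fst ℝ (Fin n → ℝ) (Fin n → ℝ)
    let G := ContinuousLinearMap.snd ℝ (Fin n → ℝ) (Fin n → ℝ)
    exact hYw.map_fun ((F + s • G).prod (F + (-s⁻¹) • G))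
  have hInd : IndepFun U V μ := by
    refine HasGaussianLaw.indepFun_of_covariance_eval (X := fun i ω => U ω i)
      (Y := fun i ω => V ω i) hUV fun i j => ?_
    rw [Cg]
    have : 1 + s * -s⁻¹ = 0 := by field_simp; ring
    rw [this, zero_mul]
  have hUlaw : Measure.map U μ = mvGaussian θ ((1 + α) • Sig) hSiga := by
    have := hUV.fst.isGaussian_map
    have := cb_isGaussian θ hSiga
    apply cb_ext
    · intro i
      rw [cb_mean, integral_map hU.aemeasurable
        (Measurable.aestronglyMeasurable (by fun_prop))]
      exact Eg s i
    · intro i j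
      rw [cb_cov, covariance_map (Measurable.aestronglyMeasurable (by fun_prop))
        (Measurable.aestronglyMeasurable (by fun_prop)) hU.aemeasurable]
      refine (Cg s s i j).trans ?_
      rw [hss]
      simp
  rw [← hUlaw] at hgint ⊢
  have mgU : ∀ i, MemLp (fun y => θ i - g y i) 2 (μ.map U) := by
    intro i
    have : IsProbabilityMeasure (μ.map U) := Measure.isProbabilityMeasure_map hU.aemeasurable
    exact (memLp_const _).sub (cb_memLp_of_quad _ hM g hg hgint i)
  have md : ∀ i, MemLp (fun ω => θ i - g (U ω) i) 2 μ := by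
    intro i
    exact (mgU i).comp_of_map hU.aemeasurable
  have mv : ∀ i, MemLp (fun ω => V ω i - θ i) 2 μ := fun i => (mg _ i).sub (memLp_const _)
  have Ev : ∀ i, ∫ ω, (V ω i - θ i) ∂μ = 0 := by
    intro i
    rw [integral_sub ((mg _ i).integrable (by norm_num)) (integrable_const _), Eg]
    simp
  have Evv : ∀ i j, ∫ ω, (V ω i - θ i) * (V ω j - θ j) ∂μ = (1 + 1 / α) * Sig i j := by
    intro i j
    have := Cg (-s⁻¹) (-s⁻¹) i j
    rw [covariance, Eg, Eg] at this
    rw [this]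
    congr 2
    rw [← hss]
    field_simp
  have Eww : ∀ i j, ∫ ω, w ω i * w ω j ∂μ = Sig i j := by
    intro i j
    have := Cw i j
    rw [covariance, Ew, Ew] at this
    simpa using this
  have Evd : ∀ i j, ∫ ω, (V ω i - θ i) * (θ j - g (U ω) j) ∂μ = 0 := by
    intro i j
    have h1 : IndepFun (fun ω => V ω i - θ i) (fun ω => θ j - g (U ω) j) μ :=
      hInd.symm.comp (φ := fun v : Fin n → ℝ => v i - θ i) (ψ := fun u => θ j - g u j)
        (by fun_prop) (by fun_prop)
    rw [h1.integral_fun_mul_eq_mul_integral (mv i).aestronglyMeasurable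
      (md j).aestronglyMeasurable, Ev, zero_mul]
  have hrw : ∀ ω', (((fun i => Y ω' i - w ω' i / s
              - g (fun j => Y ω' j + s * w ω' j) i)
            ⬝ᵥ M.mulVec (fun i => Y ω' i - w ω' i / s
              - g (fun j => Y ω' j + s * w ω' j) i))
          - (w ω' ⬝ᵥ M.mulVec (w ω')) / α) =
      ∑ i, ∑ j, M i j * ((V ω' i - θ i) * (V ω' j - θ j) + (V ω' i - θ i) * (θ j - g (U ω') j)
        + (V ω' j - θ j) * (θ i - g (U ω') i) + (θ i - g (U ω') i) * (θ j - g (U ω') j)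
        - α⁻¹ * (w ω' i * w ω' j)) := by
    intro ω'
    rw [cb_quad, cb_quad, Finset.sum_div, ← Finset.sum_sub_distrib]
    refine Finset.sum_congr rfl fun i _ => ?_
    rw [Finset.sum_div, ← Finset.sum_sub_distrib]
    refine Finset.sum_congr rfl fun j _ => ?_
    simp only [U, V]
    ring
  simp only [hrw]
  have i1 : ∀ i j, Integrable (fun ω => (V ω i - θ i) * (V ω j - θ j)) μ := fun i j =>
    (mv i).integrable_mul (mv j)
  have i2 : ∀ i j, Integrable (fun ω => (V ω i - θ i) * (θ j - g (U ω) j)) μ := fun i j =>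
    (mv i).integrable_mul (md j)
  have i3 : ∀ i j, Integrable (fun ω => (θ i - g (U ω) i) * (θ j - g (U ω) j)) μ := fun i j =>
    (md i).integrable_mul (md j)
  have i4 : ∀ i j, Integrable (fun ω => α⁻¹ * (w ω i * w ω j)) μ := fun i j =>
    ((mw i).integrable_mul (mw j)).const_mul α⁻¹
  have i12 : ∀ i j, Integrable (fun ω => (V ω i - θ i) * (V ω j - θ j) + (V ω i - θ i) * (θ j - g (U ω) j)) μ := fun i j =>
    (i1 i j).add (i2 i j)
  have i123 : ∀ i j, Integrable (fun ω => (V ω i - θ i) * (V ω j - θ j) + (V ω i - θ i) * (θ j - g (U ω) j)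
    + (V ω j - θ j) * (θ i - g (U ω) i)) μ := fun i j =>
    (i12 i j).add (i2 j i)
  have i1234 : ∀ i j, Integrable (fun ω => (V ω i - θ i) * (V ω j - θ j) + (V ω i - θ i) * (θ j - g (U ω) j)
    + (V ω j - θ j) * (θ i - g (U ω) i) + (θ i - g (U ω) i) * (θ j - g (U ω) j)) μ := fun i j =>
    (i123 i j).add (i3 i j)
  have i5 : ∀ i j, Integrable (fun ω => M i j * ((θ i - g (U ω) i) * (θ j - g (U ω) j))) μ :=
    fun i j => (i3 i j).const_mul _
  have hI : ∀ i j, Integrable (fun ω' => M i j * ((V ω' i - θ i) * (V ω' j - θ j)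
        + (V ω' i - θ i) * (θ j - g (U ω') j)
        + (V ω' j - θ j) * (θ i - g (U ω') i) + (θ i - g (U ω') i) * (θ j - g (U ω') j)
        - α⁻¹ * (w ω' i * w ω' j))) μ := fun i j =>
    ((i1234 i j).sub (i4 i j)).const_mul _
  have hE : ∀ i j, ∫ ω', M i j * ((V ω' i - θ i) * (V ω' j - θ j)
        + (V ω' i - θ i) * (θ j - g (U ω') j)
        + (V ω' j - θ j) * (θ i - g (U ω') i) + (θ i - g (U ω') i) * (θ j - g (U ω') j)
        - α⁻¹ * (w ω' i * w ω' j)) ∂μ =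
      M i j * (∫ ω', (θ i - g (U ω') i) * (θ j - g (U ω') j) ∂μ) + M i j * Sig i j := by
    intro i j
    rw [integral_const_mul, integral_sub (i1234 i j) (i4 i j),
      integral_add (i123 i j) (i3 i j), integral_add (i12 i j) (i2 j i),
      integral_add (i1 i j) (i2 i j), integral_const_mul]
    rw [Evv, Evd, Evd, Eww]
    ring
  refine ⟨integrable_finsetSum _ fun i _ => integrable_finsetSum _ fun j _ => hI i j, ?_⟩
  rw [integral_finsetSum _ fun i _ => integrable_finsetSum _ fun j _ => hI i j]
  simp only [cb_quad]
  rw [integral_map hU.aemeasurable (Measurable.aestronglyMeasurable (by fun_prop)),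
    integral_finsetSum _ fun i _ => integrable_finsetSum _ fun j _ => i5 i j]
  simp only [Matrix.trace, Matrix.diag, Matrix.mul_apply]
  rw [← Finset.sum_add_distrib]
  refine Finset.sum_congr rfl fun i _ => ?_
  rw [integral_finsetSum _ fun j _ => hI i j,
    integral_finsetSum _ fun j _ => i5 i j, ← Finset.sum_add_distrib]
  refine Finset.sum_congr rfl fun j _ => ?_
  rw [hE, integral_const_mul]
  have hsym : Sig j i = Sig i j := by simpa using hSig.1.apply i j
  rw [hsym]

/-- **Unbiasedness of the coupled bootstrap with structured errors (Corollary 2).**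
Let `Y ~ N(θ, Σ)` with `Σ` positive definite, let `A` be positive definite with
`‖x‖_A² = xᵀ A⁻¹ x`, let `ω¹, …, ω^B` be i.i.d. `N(0, Σ)` independent of `Y`, and set
`Y^{*b} = Y + √α ωᵇ`, `Y^{†b} = Y - ωᵇ/√α`.  For measurable `g` with
`E‖g(Y_α)‖_A² < ∞` (where `Y_α ~ N(θ, (1+α) Σ)`), the estimator
`CB_{A,α}(g) = B⁻¹ ∑_b (‖Y^{†b} - g(Y^{*b})‖_A² - ‖ωᵇ‖_A²/α) - tr(A⁻¹ Σ)` satisfies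
`E[CB_{A,α}(g)] = E‖θ - g(Y_α)‖_A²`. -/
theorem structured_coupled_bootstrap_unbiased
    {Ω : Type*} [MeasurableSpace Ω] {μ : Measure Ω} [IsProbabilityMeasure μ]
    {n : ℕ} (θ : Fin n → ℝ)
    (Sig A : Matrix (Fin n) (Fin n) ℝ) (hSig : Sig.PosDef) (hA : A.PosDef)
    (α : ℝ) (hα : 0 < α) (hSiga : ((1 + α) • Sig).PosSemidef)
    (B : ℕ) (hB : 1 ≤ B)
    (Y : Ω → (Fin n → ℝ)) (w : Fin B → Ω → (Fin n → ℝ))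
    (hY : Measurable Y) (hw : ∀ b, Measurable (w b))
    (hIndep : iIndepFun
      (fun o : Option (Fin B) => Option.elim o Y w) μ)
    (hYlaw : Measure.map Y μ = mvGaussian θ Sig hSig.posSemidef)
    (hwlaw : ∀ b, Measure.map (w b) μ = mvGaussian 0 Sig hSig.posSemidef)
    (g : (Fin n → ℝ) → (Fin n → ℝ)) (hg : Measurable g)
    (hgint : Integrable (fun y => g y ⬝ᵥ A⁻¹.mulVec (g y))
      (mvGaussian θ ((1 + α) • Sig) hSiga)) :
    (∫ ω', ((B : ℝ)⁻¹ * (∑ b,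
        (((fun i => Y ω' i - w b ω' i / Real.sqrt α
              - g (fun j => Y ω' j + Real.sqrt α * w b ω' j) i)
            ⬝ᵥ A⁻¹.mulVec (fun i => Y ω' i - w b ω' i / Real.sqrt α
              - g (fun j => Y ω' j + Real.sqrt α * w b ω' j) i))
          - (w b ω' ⬝ᵥ A⁻¹.mulVec (w b ω')) / α))
        - (A⁻¹ * Sig).trace) ∂μ)
      = ∫ y, (fun i => θ i - g y i) ⬝ᵥ A⁻¹.mulVec (fun i => θ i - g y i)
          ∂(mvGaussian θ ((1 + α) • Sig) hSiga) := by
  have key := fun b => cb_single θ Sig A⁻¹ hSig.posSemidef hA.inv α hα hSiga Y (w b) hY (hw b)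
    (hIndep.indepFun (i := none) (j := some b) (by simp)) hYlaw (hwlaw b) g hg hgint
  rw [integral_sub ((integrable_finsetSum _ fun b _ => (key b).1).const_mul _)
    (integrable_const _), integral_const_mul, integral_finsetSum _ fun b _ => (key b).1,
    Finset.sum_congr rfl fun b _ => (key b).2]
  have hB' : (B : ℝ) ≠ 0 := by positivity
  simp only [Finset.sum_const, Finset.card_univ, Fintype.card_fin, nsmul_eq_mul,
    integral_const, probReal_univ, one_smul]
  rw [inv_mul_cancel_left₀ hB']
  ring
end
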